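/- arXiv:1812.03362 — 4 statements merged into one kernel-verified Lean document; each statement's English description precedes it below -/
import Mathlib

section
/- For n ≥ 3 and every permutation h ∈ S_n, Σ_{g ∈ S_n} (n − fix(h∘g⁻¹))² · (fix(g) − 1) = −((2n−3)·n!/(n−1)) · (fix(h) − 1). (Equivalently: the function g ↦ fix(g) − 1 is an eigenfunction of convolution with μ(g) = −(1/2)·d_H(g, e)², with eigenvalue (2n−3)·n!/(2n−2), where d_H is the Hamming distance on S_n.) -/
namespace Equiv.Perm

variable {α : Type*} [Fintype α] [DecidableEq α]

/-- The number of fixed points of a permutation. -/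
def fixCard (g : Perm α) : ℕ := (Finset.univ.filter fun i => g i = i).card

lemma fixCard_conj (s g : Perm α) : fixCard (s * g * s⁻¹) = fixCard g := by
  unfold fixCard
  refine Finset.card_bij (fun i _ => s⁻¹ i) ?_ (fun _ _ _ _ h => s⁻¹.injective h) ?_
  · intro i hi
    rw [Finset.mem_filter_univ] at hi ⊢
    exact s.injective (by simpa using hi)
  · intro i hi
    rw [Finset.mem_filter_univ] at hi
    exact ⟨s i, (Finset.mem_filter_univ _).2 (by simp [hi]), by simp⟩

/-- The permutation `g` fixes exactly `(fixCard g).descFactorial k` injective `k`-tuples. -/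
lemma card_fixedBy_embedding (g : Perm α) (k : ℕ) :
    Fintype.card (MulAction.fixedBy (Fin k ↪ α) g) = (fixCard g).descFactorial k := by
  have e : MulAction.fixedBy (Fin k ↪ α) g ≃ (Fin k ↪ {i : α | g i = i}) :=
    (Equiv.subtypeEquivRight fun x => by
      simp [MulAction.mem_fixedBy, DFunLike.ext_iff, Function.Embedding.smul_apply]).trans
      (Equiv.codRestrict (Fin k) {i : α | g i = i})
  rw [Fintype.card_congr e, Fintype.card_embedding_eq, Fintype.card_fin]
  congr 1
  exact Fintype.card_subtype _

/-- The factorial moments of the number of fixed points of order at most `card α` are `1`. -/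
lemma sum_descFactorial_fixCard (k : ℕ) (hk : k ≤ Fintype.card α) :
    ∑ g : Perm α, (fixCard g).descFactorial k = (Fintype.card α).factorial := by
  classical
  have hpre := isMultiplyPretransitive α k
  have hne : Nonempty (Fin k ↪ α) := Function.Embedding.nonempty_of_card_le (by simpa using hk)
  have hu := (MulAction.pretransitive_iff_unique_quotient_of_nonempty (Perm α) (Fin k ↪ α)).1 hpre
  have hb := MulAction.sum_card_fixedBy_eq_card_orbits_mul_card_group (Perm α) (Fin k ↪ α)
  have : Fintype.card (Quotient (MulAction.orbitRel (Perm α) (Fin k ↪ α))) = 1 :=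
    Fintype.card_eq_one_iff_nonempty_unique.2 hu
  rw [this, one_mul, Fintype.card_perm] at hb
  rw [← hb]
  exact Finset.sum_congr rfl fun g _ => by rw [← card_fixedBy_embedding]

lemma sum_fixCard (hα : 1 ≤ Fintype.card α) :
    ∑ g : Perm α, (fixCard g : ℝ) = (Fintype.card α).factorial := by
  have h1 := sum_descFactorial_fixCard 1 hα
  simp only [Nat.descFactorial_one] at h1
  exact_mod_cast h1

lemma sum_fixCard_sq (hα : 2 ≤ Fintype.card α) :
    ∑ g : Perm α, (fixCard g : ℝ) ^ 2 = 2 * (Fintype.card α).factorial := by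
  have h2 := congrArg (Nat.cast (R := ℝ)) (sum_descFactorial_fixCard 2 hα)
  simp only [Nat.cast_sum, Nat.cast_descFactorial_two, mul_sub, mul_one, Finset.sum_sub_distrib,
    ← pow_two, sum_fixCard (one_le_two.trans hα)] at h2
  linarith

lemma sum_fixCard_cube (hα : 3 ≤ Fintype.card α) :
    ∑ g : Perm α, (fixCard g : ℝ) ^ 3 = 5 * (Fintype.card α).factorial := by
  have h3 := congrArg (Nat.cast (R := ℝ)) (sum_descFactorial_fixCard 3 hα)
  have key (m : ℕ) : (m.descFactorial 3 : ℝ) = (m : ℝ) ^ 3 - 3 * (m : ℝ) ^ 2 + 2 * m := by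
    rcases m with _ | _ | m
    · simp
    · simp; norm_num
    · simp [Nat.descFactorial_succ]; ring
  simp only [Nat.cast_sum, key, Finset.sum_sub_distrib, Finset.sum_add_distrib,
    ← Finset.mul_sum, sum_fixCard (show 1 ≤ Fintype.card α by omega),
    sum_fixCard_sq (show 2 ≤ Fintype.card α by omega)] at h3
  linarith

/-- The entries of `∑ g, c g • P g⁻¹`, with `P` the permutation representation. -/
def permSum (c : Perm α → ℝ) (i j : α) : ℝ := ∑ g : Perm α, c g * if g i = j then 1 else 0

lemma permSum_apply_apply {c : Perm α → ℝ} (hc : ∀ s g, c (s * g * s⁻¹) = c g) (s : Perm α)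
    (i j : α) : permSum c (s i) (s j) = permSum c i j := by
  unfold permSum
  rw [← Equiv.sum_comp (MulAut.conj s).toEquiv]
  refine Finset.sum_congr rfl fun g _ => ?_
  simp [hc]

lemma sum_permSum_self (c : Perm α → ℝ) :
    ∑ i, permSum c i i = ∑ g, c g * fixCard g := by
  unfold permSum fixCard
  rw [Finset.sum_comm]
  simp only [← Finset.mul_sum, Finset.sum_boole]

lemma sum_permSum (c : Perm α → ℝ) (i : α) : ∑ j, permSum c i j = ∑ g, c g := by
  unfold permSum
  rw [Finset.sum_comm]
  simp

lemma sum_permSum_apply (c : Perm α → ℝ) (h : Perm α) :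
    ∑ i, permSum c i (h i) = ∑ g, c g * fixCard (g⁻¹ * h) := by
  unfold permSum fixCard
  rw [Finset.sum_comm]
  refine Finset.sum_congr rfl fun g _ => ?_
  simp only [← Finset.mul_sum, Finset.sum_boole, mul_apply, inv_eq_iff_eq, @eq_comm _ (h _)]

/-- Convolution with a class function acts on `fixCard - 1`, the character of the
standard representation, by a scalar. -/
theorem sum_mul_fixCard_sub_one {c : Perm α → ℝ} (hc : ∀ s g, c (s * g * s⁻¹) = c g)
    (hα : 2 ≤ Fintype.card α) (h : Perm α) :
    ((Fintype.card α : ℝ) - 1) * ∑ g, c (h * g⁻¹) * ((fixCard g : ℝ) - 1) =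
      (∑ g, c g * ((fixCard g : ℝ) - 1)) * ((fixCard h : ℝ) - 1) := by
  obtain ⟨a, b, hab⟩ := Fintype.one_lt_card_iff.1 hα
  have hdiag (i) : permSum c i i = permSum c a a := by
    simpa using (permSum_apply_apply hc (swap a i) a a)
  have hoff (i j) (hij : i ≠ j) : permSum c i j = permSum c a b := by
    obtain ⟨s, rfl, rfl⟩ := MulAction.is_two_pretransitive_iff.1
      (isMultiplyPretransitive α 2) hab hij
    exact permSum_apply_apply hc s a b
  have hval (i j) : permSum c i j =
      permSum c a b + (permSum c a a - permSum c a b) * if j = i then 1 else 0 := by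
    split_ifs with hij
    · rw [hij, hdiag]; ring
    · rw [hoff i j (Ne.symm hij)]; ring
  have htrace := sum_permSum_self c
  have hrow := sum_permSum c a
  have hconv := sum_permSum_apply c h
  simp only [hdiag, Finset.sum_const, Finset.card_univ, nsmul_eq_mul] at htrace
  rw [Finset.sum_congr rfl fun j _ => hval a j] at hrow
  simp only [Finset.sum_add_distrib, ← Finset.mul_sum, Finset.sum_const,
    Finset.card_univ, nsmul_eq_mul, Finset.sum_ite_eq', Finset.mem_univ, if_true] at hrow
  rw [Finset.sum_congr rfl fun i _ => hval i (h i)] at hconv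
  simp only [Finset.sum_add_distrib, ← Finset.mul_sum, Finset.sum_const,
    Finset.card_univ, nsmul_eq_mul, Finset.sum_boole] at hconv
  change _ + _ * (fixCard h : ℝ) = _ at hconv
  have hreindex : ∑ g, c (h * g⁻¹) * ((fixCard g : ℝ) - 1) =
      ∑ g, c g * ((fixCard (g⁻¹ * h) : ℝ) - 1) := by
    rw [← Equiv.sum_comp (Equiv.divLeft h)]
    refine Finset.sum_congr rfl fun g _ => ?_
    have hfix : fixCard (h * g⁻¹) = fixCard (g⁻¹ * h) := by
      rw [← fixCard_conj h (g⁻¹ * h)]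
      congr 1
      group
    simp [div_eq_mul_inv, ← mul_assoc, hc, hfix]
  rw [hreindex]
  simp only [mul_sub, mul_one, Finset.sum_sub_distrib]
  simp only [← htrace, ← hrow, ← hconv]
  ring

end Equiv.Perm

/-- For `n ≥ 3` and every `h ∈ S_n`,
`∑_{g ∈ S_n} (n − fix(h g⁻¹))² (fix g − 1) = −((2n−3) n!/(n−1)) (fix h − 1)`;
i.e. `g ↦ fix g − 1` is an eigenfunction of convolution with
`μ(g) = −(1/2) d_H(g, e)²`, with eigenvalue `(2n−3) n!/(2n−2)`. -/
theorem standard_character_eigenfunction_hamming (n : ℕ) (hn : 3 ≤ n)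
    (h : Equiv.Perm (Fin n)) :
    ∑ g : Equiv.Perm (Fin n),
        ((n : ℝ) - (Finset.univ.filter fun i => (h * g⁻¹) i = i).card) ^ 2 *
          (((Finset.univ.filter fun i => g i = i).card : ℝ) - 1) =
      -((2 * (n : ℝ) - 3) * (Nat.factorial n : ℝ) / ((n : ℝ) - 1)) *
        (((Finset.univ.filter fun i => h i = i).card : ℝ) - 1) := by
  have hn' : Fintype.card (Fin n) = n := Fintype.card_fin n
  have hn1 : (n : ℝ) - 1 ≠ 0 := by
    have : (3 : ℝ) ≤ n := by exact_mod_cast hn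
    linarith
  have hconv := Equiv.Perm.sum_mul_fixCard_sub_one
    (c := fun g : Equiv.Perm (Fin n) => ((n : ℝ) - Equiv.Perm.fixCard g) ^ 2)
    (fun s g => by simp only [Equiv.Perm.fixCard_conj]) (by omega) h
  have hexp (g : Equiv.Perm (Fin n)) :
      ((n : ℝ) - g.fixCard) ^ 2 * ((g.fixCard : ℝ) - 1) =
        (g.fixCard : ℝ) ^ 3 - (2 * n + 1) * (g.fixCard : ℝ) ^ 2 +
          (n ^ 2 + 2 * n) * (g.fixCard : ℝ) - n ^ 2 := by ring
  simp only [hexp, Finset.sum_sub_distrib, Finset.sum_add_distrib, ← Finset.mul_sum,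
    Equiv.Perm.sum_fixCard_cube (hn'.symm ▸ hn),
    Equiv.Perm.sum_fixCard_sq (show 2 ≤ Fintype.card (Fin n) by omega),
    Equiv.Perm.sum_fixCard (show 1 ≤ Fintype.card (Fin n) by omega), Finset.sum_const,
    Finset.card_univ, Fintype.card_perm, hn', nsmul_eq_mul] at hconv
  change ∑ g : Equiv.Perm (Fin n), ((n : ℝ) - (h * g⁻¹).fixCard) ^ 2 * ((g.fixCard : ℝ) - 1) =
    _ * ((h.fixCard : ℝ) - 1)
  apply mul_left_cancel₀ hn1
  rw [hconv]
  field_simp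
  ring
end

section
/- Let k ≥ 1, let X = (ZMod 2)^k with the Hamming distance, and let M = −(1/2)·H (D ∘ D) H be the centered MDS matrix of this finite metric space (a 2^k × 2^k real matrix). Then the rank of M equals k + k(k−1)/2. -/
/-- The sign character of `ZMod 2`, with values `1` at `0` and `-1` at `1`. -/
def signChar (x : ZMod 2) : ℝ := if x = 0 then 1 else -1

/-- The Walsh character of the cube `(ZMod 2)^ι` attached to a set of coordinates. -/
def walsh {ι : Type*} (s : Finset ι) (g : ι → ZMod 2) : ℝ := ∏ i ∈ s, signChar (g i)

theorem signChar_mul_self (x : ZMod 2) : signChar x * signChar x = 1 := by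
  unfold signChar; split_ifs <;> norm_num

theorem signChar_mul_signChar (x y : ZMod 2) :
    signChar x * signChar y = if x = y then 1 else -1 := by
  have h : x = y ↔ (x = 0 ↔ y = 0) := by
    revert x y
    decide
  simp only [h, signChar]
  by_cases hx : x = 0 <;> by_cases hy : y = 0 <;> simp [hx, hy]

theorem sum_signChar : ∑ x : ZMod 2, signChar x = 0 := by
  have h : (Finset.univ : Finset (ZMod 2)) = {0, 1} := rfl
  rw [h, Finset.sum_pair (by decide)]
  simp [signChar]

theorem sum_walsh_mul_walsh {ι : Type*} [Fintype ι] [DecidableEq ι] (s t : Finset ι) :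
    ∑ g : ι → ZMod 2, walsh s g * walsh t g = if s = t then (2 : ℝ) ^ Fintype.card ι else 0 := by
  have h : ∀ g : ι → ZMod 2, walsh s g * walsh t g =
      ∏ i, ((if i ∈ s then signChar (g i) else 1) * (if i ∈ t then signChar (g i) else 1)) := by
    intro g
    simp only [walsh, Finset.prod_mul_distrib, Finset.prod_ite_mem, Finset.univ_inter]
  simp_rw [h]
  rw [← Fintype.prod_sum (fun i (x : ZMod 2) =>
    (if i ∈ s then signChar x else 1) * (if i ∈ t then signChar x else 1))]
  split_ifs with hst
  · subst hst
    have h2 : ∀ i, ∑ x : ZMod 2,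
        (if i ∈ s then signChar x else 1) * (if i ∈ s then signChar x else 1) = 2 := by
      intro i
      split_ifs <;> simp [signChar_mul_self]
    simp only [h2, Finset.prod_const, Finset.card_univ]
  · obtain ⟨i, hi⟩ : ∃ i, ¬ (i ∈ s ↔ i ∈ t) := by
      by_contra! hc
      exact hst (Finset.ext hc)
    refine Finset.prod_eq_zero (Finset.mem_univ i) ?_
    by_cases his : i ∈ s <;> by_cases hit : i ∈ t <;> simp_all [sum_signChar]

theorem sum_sq_eq_sum_powersetCard_two {ι R : Type*} [DecidableEq ι] [CommRing R]
    (u : ι → R) (s : Finset ι) :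
    (∑ i ∈ s, u i) ^ 2 = ∑ i ∈ s, u i ^ 2 + 2 * ∑ t ∈ s.powersetCard 2, ∏ i ∈ t, u i := by
  induction s using Finset.induction_on with
  | empty => simp [Finset.powersetCard_eq_empty.2 (show (∅ : Finset ι).card < 2 by simp)]
  | insert a s ha ih =>
    have hd : Disjoint (s.powersetCard 2) ((s.powersetCard 1).image (insert a)) := by
      rw [Finset.disjoint_left]
      intro t ht ht'
      obtain ⟨r, -, rfl⟩ := Finset.mem_image.1 ht'
      exact ha ((Finset.mem_powersetCard.1 ht).1 (Finset.mem_insert_self a r))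
    have hi : ∑ t ∈ (s.powersetCard 1).image (insert a), ∏ i ∈ t, u i = u a * ∑ i ∈ s, u i := by
      rw [Finset.powersetCard_one, Finset.map_eq_image, Finset.image_image,
        Finset.sum_image, Finset.mul_sum]
      · refine Finset.sum_congr rfl fun i hi => ?_
        exact Finset.prod_pair (by rintro rfl; exact ha hi)
      · intro i hi j hj hij
        have : i ∈ ({a, j} : Finset ι) := by
          rw [← show _ = ({a, j} : Finset ι) from hij]; simp
        rcases Finset.mem_insert.1 this with rfl | h
        · exact absurd hi ha
        · exact Finset.mem_singleton.1 h
    rw [Finset.powersetCard_succ_insert ha, Finset.sum_union hd, hi, Finset.sum_insert ha,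
      Finset.sum_insert ha, add_sq, ih]
    ring

theorem hammingDist_eq_sum_signChar {ι : Type*} [Fintype ι] (g h : ι → ZMod 2) :
    (hammingDist g h : ℝ) =
      (Fintype.card ι - ∑ i, signChar (g i) * signChar (h i)) / 2 := by
  have hi : ∀ i, (if g i ≠ h i then (1 : ℝ) else 0) =
      (1 - signChar (g i) * signChar (h i)) / 2 := by
    intro i
    rw [signChar_mul_signChar]
    by_cases hgh : g i = h i <;> simp [hgh]
  rw [hammingDist, Finset.card_filter]
  push_cast
  rw [Finset.sum_congr rfl fun i _ => hi i, ← Finset.sum_div]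
  simp

theorem hammingDist_sq_eq_sum_walsh {ι : Type*} [Fintype ι] [DecidableEq ι]
    (g h : ι → ZMod 2) :
    (hammingDist g h : ℝ) * hammingDist g h =
      ((Fintype.card ι : ℝ) ^ 2 + Fintype.card ι) / 4
        - Fintype.card ι / 2 * ∑ s ∈ Finset.univ.powersetCard 1, walsh s g * walsh s h
        + 1 / 2 * ∑ s ∈ Finset.univ.powersetCard 2, walsh s g * walsh s h := by
  have hsq := sum_sq_eq_sum_powersetCard_two
    (fun i => signChar (g i) * signChar (h i)) Finset.univ
  have hone : ∀ i, (signChar (g i) * signChar (h i)) ^ 2 = 1 := by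
    intro i
    rw [mul_pow, sq, sq, signChar_mul_self, signChar_mul_self, one_mul]
  simp only [hone, Finset.prod_mul_distrib, Finset.sum_const, Finset.card_univ,
    nsmul_eq_mul, mul_one] at hsq
  rw [hammingDist_eq_sum_signChar, Finset.powersetCard_one, Finset.sum_map]
  simp only [walsh, Function.Embedding.coeFn_mk, Finset.prod_singleton]
  linear_combination hsq / 4

/-- If `B` has orthogonal columns of equal nonzero norm, then `B * diagonal c * Bᵀ` has full rank
on the index set of the columns when no `c i` vanishes. -/
theorem rank_mul_diagonal_mul_transpose {m n K : Type*} [Fintype m] [Fintype n] [DecidableEq n]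
    [Field K] (B : Matrix m n K) (c : n → K) (a : K) (ha : a ≠ 0) (hc : ∀ i, c i ≠ 0)
    (hB : B.transpose * B = a • (1 : Matrix n n K)) :
    (B * Matrix.diagonal c * B.transpose).rank = Fintype.card n := by
  apply le_antisymm
  · exact (Matrix.rank_mul_le_right _ _).trans (Matrix.rank_le_card_height _)
  · have hconj : B.transpose * (B * Matrix.diagonal c * B.transpose) * B =
        Matrix.diagonal fun i => a * a * c i := by
      calc _ = (B.transpose * B) * Matrix.diagonal c * (B.transpose * B) := by
            simp only [Matrix.mul_assoc]
        _ = _ := by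
            rw [hB]
            ext i j
            by_cases hij : i = j <;> simp [hij, mul_assoc]
    have hu : IsUnit (Matrix.diagonal fun i => a * a * c i) := by
      rw [Matrix.isUnit_diagonal, Pi.isUnit_iff]
      exact fun i => (mul_ne_zero (mul_ne_zero ha ha) (hc i)).isUnit
    rw [← Matrix.rank_of_isUnit _ hu, ← hconj]
    exact (Matrix.rank_mul_le_left _ _).trans (Matrix.rank_mul_le_right _ _)

/-- For `k ≥ 1`, the centered MDS matrix
`M = −(1/2) H (D ∘ D) H` of `(ZMod 2)^k` with the Hamming distance has rank
`k + k(k−1)/2`. -/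
theorem mds_rank_hamming_cube (k : ℕ) (hk : 1 ≤ k)
    (D : Matrix (Fin k → ZMod 2) (Fin k → ZMod 2) ℝ)
    (hD : ∀ g h : Fin k → ZMod 2, D g h = (hammingDist g h : ℝ))
    (H : Matrix (Fin k → ZMod 2) (Fin k → ZMod 2) ℝ)
    (hH : H = 1 - (Fintype.card (Fin k → ZMod 2) : ℝ)⁻¹ • Matrix.of fun _ _ => (1 : ℝ))
    (M : Matrix (Fin k → ZMod 2) (Fin k → ZMod 2) ℝ)
    (hM : M = (-(1/2 : ℝ)) • (H * (Matrix.hadamard D D) * H)) :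
    M.rank = k + k * (k - 1) / 2 := by
  set J : Matrix (Fin k → ZMod 2) (Fin k → ZMod 2) ℝ := Matrix.of fun _ _ => (1 : ℝ)
  let P : Finset (Finset (Fin k)) :=
    Finset.univ.powersetCard 1 ∪ Finset.univ.powersetCard 2
  have hdisj : Disjoint ((Finset.univ : Finset (Fin k)).powersetCard 1)
      (Finset.univ.powersetCard 2) :=
    Finset.pairwise_disjoint_powersetCard _ (by decide)
  let c : Finset (Fin k) → ℝ := fun s => if s.card = 1 then k / 4 else -(1 / 4)
  let B : Matrix (Fin k → ZMod 2) P ℝ := Matrix.of fun g s => walsh s.1 g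
  let C : Matrix P P ℝ := Matrix.diagonal fun s => c s
  have hk0 : (k : ℝ) ≠ 0 := by exact_mod_cast (by omega : k ≠ 0)
  have hBB : B.transpose * B = (2 : ℝ) ^ k • (1 : Matrix P P ℝ) := by
    ext s t
    rw [Matrix.mul_apply, Matrix.smul_apply, Matrix.one_apply]
    simp only [B, Matrix.transpose_apply, Matrix.of_apply, sum_walsh_mul_walsh,
      Fintype.card_fin, Subtype.ext_iff, smul_eq_mul, mul_ite, mul_one, mul_zero]
  have hJB : J * B = 0 := by
    ext g s
    have hs : (∅ : Finset (Fin k)) ≠ s.1 := by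
      intro h
      have := s.2
      rw [← h] at this
      simp [P] at this
    have h0 := sum_walsh_mul_walsh ∅ s.1
    rw [if_neg hs] at h0
    simpa [J, B, Matrix.mul_apply, walsh] using h0
  have hHB : H * B = B := by
    rw [hH, Matrix.sub_mul, Matrix.smul_mul, hJB, Matrix.one_mul, smul_zero, sub_zero]
  have hHT : H.transpose = H := by
    rw [hH, Matrix.transpose_sub, Matrix.transpose_smul, Matrix.transpose_one]
    rfl
  have hBH : B.transpose * H = B.transpose := by
    rw [← hHT, ← Matrix.transpose_mul, hHB]
  have hHJ : H * J = 0 := by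
    rw [hH, Matrix.sub_mul, Matrix.smul_mul, Matrix.one_mul]
    ext g h
    simp [J, Matrix.mul_apply]
  have hDD : Matrix.hadamard D D =
      (((k : ℝ) ^ 2 + k) / 4) • J - (2 : ℝ) • (B * C * B.transpose) := by
    ext g h
    have hsum : (B * C * B.transpose) g h =
        k / 4 * ∑ s ∈ Finset.univ.powersetCard 1, walsh s g * walsh s h
          - 1 / 4 * ∑ s ∈ Finset.univ.powersetCard 2, walsh s g * walsh s h := by
      rw [Matrix.mul_apply]
      simp only [B, C, Matrix.mul_diagonal, Matrix.of_apply, Matrix.transpose_apply]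
      rw [Finset.sum_coe_sort P (fun s => walsh s g * c s * walsh s h),
        Finset.sum_union hdisj, sub_eq_add_neg, ← neg_mul, Finset.mul_sum, Finset.mul_sum]
      congr 1 <;> refine Finset.sum_congr rfl fun s hs => ?_ <;>
        simp only [c, (Finset.mem_powersetCard.1 hs).2] <;> norm_num <;> ring
    rw [Matrix.hadamard_apply, hD, hammingDist_sq_eq_sum_walsh, Matrix.sub_apply,
      Matrix.smul_apply, Matrix.smul_apply, hsum]
    simp only [J, Matrix.of_apply, Fintype.card_fin, smul_eq_mul]
    ring
  have hMB : M = B * C * B.transpose := by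
    have hHBC : H * (B * C * B.transpose) * H = B * C * B.transpose := by
      rw [← Matrix.mul_assoc, ← Matrix.mul_assoc, hHB, Matrix.mul_assoc, hBH]
    rw [hM, hDD, Matrix.mul_sub, Matrix.mul_smul, hHJ, smul_zero, zero_sub, Matrix.mul_smul,
      Matrix.neg_mul, Matrix.smul_mul, hHBC, smul_neg, neg_smul, neg_neg, smul_smul]
    norm_num
  rw [hMB, rank_mul_diagonal_mul_transpose B _ _ (by positivity) _ hBB]
  · rw [Fintype.card_coe, Finset.card_union_of_disjoint hdisj]
    simp [Nat.choose_two_right]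
  · intro s
    dsimp only [c]
    split_ifs
    · exact div_ne_zero hk0 (by norm_num)
    · norm_num
end

section
/- Let n ≥ 3, let X = S_n with the Hamming distance d_H(g, h) = #{i : g(i) ≠ h(i)}, and let M = −(1/2)·H (D ∘ D) H be the centered MDS matrix of this finite metric space (an n! × n! real matrix). Then the rank of M equals (n−1)² + ((n−1)(n−2)/2)² + (n(n−3)/2)². -/
variable {G : Type*} [Group G]

/-- `χ` is the trace of a multiplicative map `G → Mat_ι(ℝ)`, for some finite `ι`; the map need not
send `1` to `1`, so it is a representation on the image of the idempotent `ρ 1`. -/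
def IsMatrixCharacter (χ : G → ℝ) : Prop :=
  ∃ (ι : Type) (_ : Fintype ι) (ρ : G → Matrix ι ι ℝ),
    (∀ g h, ρ (g * h) = ρ g * ρ h) ∧ ∀ g, χ g = (ρ g).trace

namespace IsMatrixCharacter

variable {χ ψ : G → ℝ}

lemma map_mul_comm (hχ : IsMatrixCharacter χ) (g h : G) : χ (g * h) = χ (h * g) := by
  obtain ⟨ι, _, ρ, hρ, hχρ⟩ := hχ
  rw [hχρ, hχρ, hρ, hρ, Matrix.trace_mul_comm]

lemma one : IsMatrixCharacter (fun _ : G => (1 : ℝ)) :=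
  ⟨Unit, inferInstance, fun _ => Matrix.of fun _ _ => 1,
    fun g h => by ext; simp [Matrix.mul_apply], fun g => by simp [Matrix.trace]⟩

/-- The symmetric (`ε = 1`) and exterior (`ε = -1`) squares. -/
lemma half_sq (hχ : IsMatrixCharacter χ) {ε : ℝ} (hε : ε * ε = 1) :
    IsMatrixCharacter (fun g => (χ g ^ 2 + ε * χ (g * g)) / 2) := by
  obtain ⟨ι, _, ρ, hρ, hχρ⟩ := hχ
  refine ⟨ι × ι, inferInstance, fun g => Matrix.of fun p q =>
    (ρ g p.1 q.1 * ρ g p.2 q.2 + ε * (ρ g p.1 q.2 * ρ g p.2 q.1)) / 2, fun g h => ?_, fun g => ?_⟩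
  · ext p q
    simp only [Matrix.of_apply, hρ, Matrix.mul_apply, Fintype.sum_prod_type]
    have key : ∀ b d : ι, ∑ x, ∑ y, (ρ g p.1 x * ρ h x b * (ρ g p.2 y * ρ h y d) +
        ρ g p.1 y * ρ h y b * (ρ g p.2 x * ρ h x d)) =
        2 * ((∑ x, ρ g p.1 x * ρ h x b) * ∑ y, ρ g p.2 y * ρ h y d) := fun b d => by
      simp only [Finset.sum_add_distrib]
      rw [Finset.sum_comm (f := fun x y => ρ g p.1 y * ρ h y b * (ρ g p.2 x * ρ h x d)),
        Finset.sum_mul_sum]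
      ring
    calc _ = (2 * ((∑ x, ρ g p.1 x * ρ h x q.1) * ∑ y, ρ g p.2 y * ρ h y q.2) +
          ε * (2 * ((∑ x, ρ g p.1 x * ρ h x q.2) * ∑ y, ρ g p.2 y * ρ h y q.1))) / 4 := by ring
      _ = _ := by
        rw [← key, ← key]
        simp only [Finset.mul_sum, ← Finset.sum_add_distrib, Finset.sum_div]
        refine Finset.sum_congr rfl fun x _ => Finset.sum_congr rfl fun y _ => ?_
        linear_combination (-(ρ g p.1 y * ρ g p.2 x * ρ h x q.2 * ρ h y q.1) / 4) * hε
  · simp only [Matrix.trace, Matrix.diag, Matrix.of_apply, Fintype.sum_prod_type] at hχρ ⊢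
    rw [hχρ, hχρ, hρ, sq, Finset.sum_mul_sum]
    simp only [Matrix.mul_apply, Finset.mul_sum, ← Finset.sum_add_distrib, Finset.sum_div]

variable [Fintype G]

/-- Schur's lemma for a character of norm one: a class function acts by a scalar. -/
lemma sum_mul_map_mul (hχ : IsMatrixCharacter χ)
    (hnorm : ∑ g, χ g⁻¹ * χ g = Fintype.card G) {f : G → ℝ}
    (hf : ∀ g h, f (g * h) = f (h * g)) (h : G) :
    (∑ g, f g * χ (g * h)) * χ 1 = (∑ g, f g * χ g) * χ h := by
  classical
  obtain ⟨ι, _, ρ, hρ, hχρ⟩ := hχ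
  have hN : (Fintype.card G : ℝ) ≠ 0 := by simp
  let φ : Matrix ι ι ℝ →ₗ[ℝ] Matrix ι ι ℝ := (Fintype.card G : ℝ)⁻¹ •
    ∑ g, (LinearMap.mulLeft ℝ (ρ g)).comp (LinearMap.mulRight ℝ (ρ g⁻¹))
  have hφ : ∀ A, φ A = (Fintype.card G : ℝ)⁻¹ • ∑ g, ρ g * (A * ρ g⁻¹) := fun A => by
    simp [φ]
  have hfix : ∀ A, (∀ g, ρ g * (A * ρ g⁻¹) = A) → φ A = A := fun A hA => by
    rw [hφ, Finset.sum_congr rfl fun g _ => hA g]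
    simp [← Nat.cast_smul_eq_nsmul ℝ, smul_smul, hN]
  have hconj : ∀ A g, ρ g * (φ A * ρ g⁻¹) = φ A := fun A g => by
    simp only [hφ, Matrix.smul_mul, Matrix.mul_smul, Finset.sum_mul, Finset.mul_sum]
    congr 1
    refine Fintype.sum_equiv (Equiv.mulLeft g) _ _ fun k => ?_
    simp [hρ, Matrix.mul_assoc]
  have hproj : LinearMap.IsProj (LinearMap.range φ) φ :=
    ⟨fun A => ⟨A, rfl⟩, by rintro _ ⟨A, rfl⟩; exact hfix _ (hconj A)⟩
  have htr : LinearMap.trace ℝ _ φ = 1 := by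
    rw [LinearMap.trace_eq_matrix_trace ℝ (Matrix.stdBasis ℝ ι ι)]
    simp only [Matrix.trace, Matrix.diag, LinearMap.toMatrix_apply, Matrix.stdBasis_eq_single,
      Fintype.sum_prod_type]
    have : ∀ i j : ι, ((Matrix.stdBasis ℝ ι ι).repr (φ (Matrix.single i j 1))) (i, j) =
        (Fintype.card G : ℝ)⁻¹ * ∑ g, ρ g i i * ρ g⁻¹ j j := by
      intro i j
      have hrepr : ∀ A : Matrix ι ι ℝ, (Matrix.stdBasis ℝ ι ι).repr A (i, j) = A i j :=
        fun A => by simp [Matrix.stdBasis]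
      rw [hrepr, hφ]
      simp [Matrix.sum_apply, Matrix.mul_apply, Matrix.single_apply, ite_and]
    simp only [this, ← Finset.mul_sum]
    rw [inv_mul_eq_iff_eq_mul₀ hN, mul_one, ← hnorm]
    simp only [hχρ, Matrix.trace, Matrix.diag, Finset.sum_mul_sum]
    rw [Finset.sum_comm (s := (Finset.univ : Finset G)), Finset.sum_comm]
    refine Finset.sum_congr rfl fun i _ => ?_
    rw [Finset.sum_comm (s := (Finset.univ : Finset G))]
    simp only [mul_comm]
  have hrank : Module.finrank ℝ (LinearMap.range φ) = 1 := by
    have := hproj.trace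
    rw [htr] at this
    exact_mod_cast this.symm
  have hQ : ρ 1 ≠ 0 := by
    intro h0
    have : ∀ g, χ g = 0 := fun g => by
      rw [hχρ, ← one_mul g, hρ, h0]; simp
    simp only [this, mul_zero, Finset.sum_const_zero] at hnorm
    exact hN hnorm.symm
  have hQmem : ρ 1 ∈ LinearMap.range φ := ⟨ρ 1, hfix _ fun g => by simp [← hρ]⟩
  have hZmem : ∑ g, f g • ρ g ∈ LinearMap.range φ := by
    refine ⟨_, hfix _ fun k => ?_⟩
    simp only [Matrix.smul_mul, Matrix.mul_smul, Finset.sum_mul, Finset.mul_sum, ← hρ]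
    refine Fintype.sum_equiv (MulAut.conj k).toEquiv _ _ fun g => ?_
    have : f (k * (g * k⁻¹)) = f g := by rw [hf]; simp
    simp [← mul_assoc, ← this]
  obtain ⟨c, hc⟩ := (finrank_eq_one_iff_of_nonzero' (⟨ρ 1, hQmem⟩ : LinearMap.range φ)
    (by simpa using hQ)).1 hrank ⟨_, hZmem⟩
  have hc : c • ρ 1 = ∑ g, f g • ρ g := congrArg Subtype.val hc
  have key : ∀ h, ∑ g, f g * χ (g * h) = c * χ h := fun h => by
    have := congrArg (fun A => (A * ρ h).trace) hc
    simpa [Finset.sum_mul, Matrix.trace_sum, ← hρ, ← hχρ] using this.symm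
  have key1 := key 1
  simp only [mul_one] at key1
  rw [key, key1]; ring

/-- A constituent of norm one and multiplicity one can be split off. -/
lemma sub (hψ : IsMatrixCharacter ψ) (hχ : IsMatrixCharacter χ)
    (hnorm : ∑ g, χ g⁻¹ * χ g = Fintype.card G) (hmult : ∑ g, ψ g⁻¹ * χ g = Fintype.card G) :
    IsMatrixCharacter (fun g => ψ g - χ g) := by
  have hN : (Fintype.card G : ℝ) ≠ 0 := by simp
  have hχχ := hχ.sum_mul_map_mul hnorm (f := fun g => χ g⁻¹)
    (fun g h => by simp only [mul_inv_rev]; exact hχ.map_mul_comm _ _)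
  have hψχ := hχ.sum_mul_map_mul hnorm (f := fun g => ψ g⁻¹)
    (fun g h => by simp only [mul_inv_rev]; exact hψ.map_mul_comm _ _)
  rw [hnorm] at hχχ
  rw [hmult] at hψχ
  have hcomm := hχ.map_mul_comm
  obtain ⟨ι, _, ρ, hρ, hψρ⟩ := hψ
  set c : ℝ := χ 1 / Fintype.card G with hc
  set p : Matrix ι ι ℝ := c • ∑ k, χ k⁻¹ • ρ k with hp
  have hpρ : ∀ g, ρ g * p = p * ρ g := fun g => by
    simp only [hp, Matrix.smul_mul, Matrix.mul_smul, Finset.sum_mul, Finset.mul_sum, ← hρ]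
    congr 1
    refine Fintype.sum_equiv (MulAut.conj g).toEquiv _ _ fun k => ?_
    have : χ (g * (k⁻¹ * g⁻¹)) = χ k⁻¹ := by rw [hcomm]; simp
    simp [mul_assoc, this]
  have hpp : p * p = p := by
    have : ∀ k, p * ρ k = c • ∑ m, χ (k * m⁻¹) • ρ m := fun k => by
      simp only [hp, Matrix.smul_mul, Finset.sum_mul, ← hρ]
      congr 1
      refine Fintype.sum_equiv (Equiv.mulRight k) _ _ fun m => ?_
      simp
    calc p * p = c • ∑ k, χ k⁻¹ • (p * ρ k) := by
          conv_lhs => enter [2]; rw [hp]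
          simp only [Matrix.mul_smul, Finset.mul_sum]
      _ = c • ∑ m, (c * ∑ k, χ k⁻¹ * χ (k * m⁻¹)) • ρ m := by
          simp only [this, Finset.smul_sum, Finset.mul_sum, Finset.sum_smul, smul_smul]
          rw [Finset.sum_comm]
          refine Finset.sum_congr rfl fun _ _ => Finset.sum_congr rfl fun _ _ => ?_
          congr 1; ring
      _ = p := by
          rw [hp]
          refine congrArg _ (Finset.sum_congr rfl fun m _ => ?_)
          congr 1
          have := hχχ m⁻¹
          rw [hc]; field_simp; linarith
  refine ⟨ι, inferInstance, fun g => ρ g - p * ρ g, fun g h => ?_, fun g => ?_⟩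
  · have h1 : ρ g * (p * ρ h) = p * ρ (g * h) := by
      rw [← mul_assoc, hpρ, mul_assoc, hρ]
    have h2 : p * ρ g * (p * ρ h) = p * ρ (g * h) := by
      rw [mul_assoc, h1, ← mul_assoc, hpp]
    rw [sub_mul, mul_sub, mul_sub, h1, h2, mul_assoc, ← hρ]
    simp only [sub_self, sub_zero]
  · rw [Matrix.trace_sub, ← hψρ]
    have : (p * ρ g).trace = c * ∑ k, χ k⁻¹ * ψ (k * g) := by
      simp [hp, Finset.sum_mul, Matrix.trace_sum, ← hρ, ← hψρ]
    rw [this]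
    have e : ∑ k, χ k⁻¹ * ψ (k * g) = ∑ k, ψ k⁻¹ * χ (k * g) := by
      refine Fintype.sum_equiv ((Equiv.mulRight g).trans (Equiv.inv G)) _ _ fun k => ?_
      simp [hcomm _ g, mul_comm]
    have := hψχ g
    rw [e, hc]; field_simp; linarith

end IsMatrixCharacter

/-- If `G` acts transitively on `X` and `f : X → X` is any map, then on average over `G` an element
agrees with `f` at exactly one point. -/
lemma MulAction.sum_card_smul_eq {G X : Type*} [Group G] [Fintype G] [Fintype X] [DecidableEq X]
    [Nonempty X] [MulAction G X] [MulAction.IsPretransitive G X] (f : X → X) :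
    ∑ g : G, (Finset.univ.filter fun x => g • x = f x).card = Fintype.card G := by
  have hcard : ∀ x y : X, (Finset.univ.filter fun g : G => g • x = y).card * Fintype.card X =
      Fintype.card G := by
    intro x y
    have hconst : ∀ z, (Finset.univ.filter fun g : G => g • x = z).card =
        (Finset.univ.filter fun g : G => g • x = y).card := by
      intro z
      obtain ⟨k, rfl⟩ := MulAction.exists_smul_eq G y z
      exact Finset.card_equiv (Equiv.mulLeft k⁻¹) fun g => by
        simp [mul_smul, inv_smul_eq_iff]
    have := Finset.card_eq_sum_card_fiberwise (s := (Finset.univ : Finset G))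
      (t := (Finset.univ : Finset X)) (f := fun g => g • x) (by simp)
    rw [Finset.card_univ] at this
    rw [this, Finset.sum_congr rfl fun z _ => hconst z]
    simp [mul_comm]
  have hswap : ∑ g : G, (Finset.univ.filter fun x => g • x = f x).card =
      ∑ x, (Finset.univ.filter fun g : G => g • x = f x).card := by
    simp only [Finset.card_filter]
    exact Finset.sum_comm
  have hX : Fintype.card X ≠ 0 := Fintype.card_ne_zero
  rw [hswap, ← mul_left_inj' hX, Finset.sum_mul, Finset.sum_congr rfl fun x _ => hcard x (f x)]
  simp [mul_comm]

namespace Equiv.Perm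

variable {α : Type*} [Fintype α] [DecidableEq α]

/-- The points fixed by `g`. -/
def fixedFinset (g : Perm α) : Finset α := Finset.univ.filter fun x => g x = x

/-- The points lying on the 2-cycles of `g`. -/
def swappedFinset (g : Perm α) : Finset α := Finset.univ.filter fun x => g x ≠ x ∧ g (g x) = x

lemma sum_card_comp_eq (k : ℕ) (τ : Perm (Fin k)) :
    ∑ g : Perm α, (Finset.univ.filter fun v : Fin k → α =>
      Function.Injective v ∧ ∀ i, g (v i) = v (τ i)).card =
      if k ≤ Fintype.card α then Fintype.card (Perm α) else 0 := by
  have hemb : ∀ g : Perm α, (Finset.univ.filter fun v : Fin k → α =>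
      Function.Injective v ∧ ∀ i, g (v i) = v (τ i)).card =
      (Finset.univ.filter fun v : Fin k ↪ α => g • v = τ.toEmbedding.trans v).card := by
    intro g
    symm
    refine Finset.card_bij (fun v _ => v) (fun v hv => ?_) (fun v _ w _ h => by ext; simp [h])
      fun v hv => ?_
    · simp only [Finset.mem_filter, Finset.mem_univ, true_and] at hv ⊢
      exact ⟨v.injective, fun i => DFunLike.congr_fun hv i⟩
    · simp only [Finset.mem_filter, Finset.mem_univ, true_and] at hv
      refine ⟨⟨v, hv.1⟩, ?_, rfl⟩
      simp only [Finset.mem_filter, Finset.mem_univ, true_and]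
      ext i
      exact hv.2 i
  simp only [hemb]
  split_ifs with hk
  · have : Nonempty (Fin k ↪ α) := Function.Embedding.nonempty_of_card_le (by simpa using hk)
    have : MulAction.IsPretransitive (Perm α) (Fin k ↪ α) := ⟨exists_smul_eq_embedding⟩
    exact MulAction.sum_card_smul_eq _
  · have : IsEmpty (Fin k ↪ α) := Function.Embedding.isEmpty_of_card_lt (by simpa using hk)
    simp

lemma card_fixed_tuples (g : Perm α) (k : ℕ) :
    (Finset.univ.filter fun v : Fin k → α =>
      Function.Injective v ∧ ∀ i, g (v i) = v ((1 : Perm (Fin k)) i)).card =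
      (fixedFinset g).card.descFactorial k := by
  have := Fintype.card_embedding_eq (α := Fin k) (β := fixedFinset g)
  rw [Fintype.card_fin, Fintype.card_coe] at this
  rw [← this, ← Finset.card_univ]
  symm
  refine Finset.card_bij (fun v _ i => (v i : α)) (fun v _ => ?_) (fun v _ w _ h => ?_)
    fun v hv => ?_
  · simp only [Finset.mem_filter, Finset.mem_univ, true_and]
    exact ⟨Subtype.val_injective.comp v.injective, fun i => 
      (Finset.mem_filter.1 (v i).2).2⟩
  · ext i; exact congrFun h i
  · simp only [Finset.mem_filter, Finset.mem_univ, true_and] at hv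
    exact ⟨⟨fun i => ⟨v i, by simpa [fixedFinset] using hv.2 i⟩,
      fun i j h => hv.1 (congrArg Subtype.val h)⟩, Finset.mem_univ _, rfl⟩

lemma card_swapped_pairs (g : Perm α) :
    (Finset.univ.filter fun v : Fin 2 → α =>
      Function.Injective v ∧ ∀ i, g (v i) = v (Equiv.swap 0 1 i)).card =
      (swappedFinset g).card := by
  symm
  refine Finset.card_bij (fun x _ => ![x, g x]) (fun x hx => ?_) (fun x _ y _ h => congrFun h 0)
    fun v hv => ?_
  · simp only [swappedFinset, Finset.mem_filter, Finset.mem_univ, true_and] at hx ⊢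
    refine ⟨?_, ?_⟩
    · intro i j; fin_cases i <;> fin_cases j <;> simp [hx.1, hx.1.symm]
    · simp [Fin.forall_fin_succ, hx.2]
  · simp only [Finset.mem_filter, Finset.mem_univ, true_and] at hv
    have h0 := hv.2 0
    have h1 := hv.2 1
    simp only [Equiv.swap_apply_left, Equiv.swap_apply_right] at h0 h1
    refine ⟨v 0, ?_, ?_⟩
    · simp only [swappedFinset, Finset.mem_filter, Finset.mem_univ, true_and]
      rw [h0]
      exact ⟨hv.1.ne (by decide), h1⟩
    · ext i; fin_cases i <;> simp [h0]

lemma card_swapped_fixed_triples (g : Perm α) :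
    (Finset.univ.filter fun v : Fin 3 → α =>
      Function.Injective v ∧ ∀ i, g (v i) = v (Equiv.swap 0 1 i)).card =
      (swappedFinset g).card * (fixedFinset g).card := by
  rw [← Finset.card_product]
  symm
  refine Finset.card_bij (fun p _ => ![p.1, g p.1, p.2]) (fun p hp => ?_)
    (fun p _ q _ h => Prod.ext (congrFun h 0) (congrFun h 2)) fun v hv => ?_
  · obtain ⟨x, y⟩ := p
    simp only [swappedFinset, fixedFinset, Finset.mem_product, Finset.mem_filter, Finset.mem_univ,
      true_and] at hp ⊢
    refine ⟨?_, ?_⟩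
    · intro i j; fin_cases i <;> fin_cases j <;> simp <;> grind
    · intro i; fin_cases i <;> simp [Equiv.swap_apply_def] <;> grind
  · simp only [Finset.mem_filter, Finset.mem_univ, true_and] at hv
    have h0 : g (v 0) = v 1 := hv.2 0
    have h1 : g (v 1) = v 0 := hv.2 1
    have h2 : g (v 2) = v 2 := hv.2 2
    refine ⟨(v 0, v 2), ?_, ?_⟩
    · simp only [swappedFinset, fixedFinset, Finset.mem_product, Finset.mem_filter,
        Finset.mem_univ, true_and]
      rw [h0]
      exact ⟨⟨hv.1.ne (by decide), h1⟩, h2⟩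
    · ext i; fin_cases i <;> simp [h0]

lemma card_swapped_fixed_quadruples (g : Perm α) :
    (Finset.univ.filter fun v : Fin 4 → α =>
      Function.Injective v ∧ ∀ i, g (v i) = v (Equiv.swap 0 1 i)).card =
      (swappedFinset g).card * ((fixedFinset g).card.descFactorial 2) := by
  have : (fixedFinset g).card.descFactorial 2 = (fixedFinset g).offDiag.card := by
    rw [Finset.offDiag_card]
    simp [Nat.descFactorial, Nat.sub_mul]
  rw [this, ← Finset.card_product]
  symm
  refine Finset.card_bij (fun p _ => ![p.1, g p.1, p.2.1, p.2.2]) (fun p hp => ?_)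
    (fun p _ q _ h => Prod.ext (congrFun h 0) (Prod.ext (congrFun h 2) (congrFun h 3)))
    fun v hv => ?_
  · obtain ⟨x, y, z⟩ := p
    simp only [swappedFinset, fixedFinset, Finset.mem_product, Finset.mem_offDiag,
      Finset.mem_filter, Finset.mem_univ, true_and] at hp ⊢
    refine ⟨?_, ?_⟩
    · intro i j; fin_cases i <;> fin_cases j <;> simp <;> grind
    · intro i; fin_cases i <;> simp [Equiv.swap_apply_def] <;> grind
  · simp only [Finset.mem_filter, Finset.mem_univ, true_and] at hv
    have h0 : g (v 0) = v 1 := hv.2 0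
    have h1 : g (v 1) = v 0 := hv.2 1
    have h2 : g (v 2) = v 2 := hv.2 2
    have h3 : g (v 3) = v 3 := hv.2 3
    refine ⟨(v 0, v 2, v 3), ?_, ?_⟩
    · simp only [swappedFinset, fixedFinset, Finset.mem_product, Finset.mem_offDiag,
        Finset.mem_filter, Finset.mem_univ, true_and]
      rw [h0]
      exact ⟨⟨hv.1.ne (by decide), h1⟩, h2, h3, hv.1.ne (by decide)⟩
    · ext i; fin_cases i <;> simp [h0]

lemma card_swapped_swapped_quadruples (g : Perm α) :
    (Finset.univ.filter fun v : Fin 4 → α => Function.Injective v ∧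
      ∀ i, g (v i) = v ((Equiv.swap 0 1 * Equiv.swap 2 3 : Perm (Fin 4)) i)).card +
      (swappedFinset g).card * 2 = (swappedFinset g).card * (swappedFinset g).card := by
  have hcard : ((swappedFinset g).sigma fun x => swappedFinset g \ {x, g x}).card +
      (swappedFinset g).card * 2 = (swappedFinset g).card * (swappedFinset g).card := by
    rw [Finset.card_sigma, ← smul_eq_mul (swappedFinset g).card 2, ← Finset.sum_const,
      ← Finset.sum_add_distrib, Finset.sum_const_nat]
    intro x hx
    simp only [swappedFinset, Finset.mem_filter, Finset.mem_univ, true_and] at hx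
    rw [← Finset.card_pair hx.1.symm, Finset.card_sdiff_add_card_eq_card]
    intro y hy
    simp only [swappedFinset, Finset.mem_insert, Finset.mem_singleton, Finset.mem_filter,
      Finset.mem_univ, true_and] at hy ⊢
    grind
  rw [← hcard]
  congr 1
  symm
  refine Finset.card_bij (fun p _ => ![p.1, g p.1, p.2, g p.2]) (fun p hp => ?_)
    (fun p _ q _ h => Sigma.ext (congrFun h 0) (heq_of_eq (congrFun h 2))) fun v hv => ?_
  · obtain ⟨x, y⟩ := p
    simp only [swappedFinset, Finset.mem_sigma, Finset.mem_sdiff, Finset.mem_insert,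
      Finset.mem_singleton, Finset.mem_filter, Finset.mem_univ, true_and] at hp ⊢
    have hinj := g.injective
    refine ⟨?_, ?_⟩
    · intro i j; fin_cases i <;> fin_cases j <;> simp <;> grind
    · intro i; fin_cases i <;> simp [Equiv.swap_apply_def] <;> grind
  · simp only [Finset.mem_filter, Finset.mem_univ, true_and] at hv
    have h0 : g (v 0) = v 1 := hv.2 0
    have h1 : g (v 1) = v 0 := hv.2 1
    have h2 : g (v 2) = v 3 := hv.2 2
    have h3 : g (v 3) = v 2 := hv.2 3
    refine ⟨⟨v 0, v 2⟩, ?_, ?_⟩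
    · simp only [swappedFinset, Finset.mem_sigma, Finset.mem_sdiff, Finset.mem_insert,
        Finset.mem_singleton, Finset.mem_filter, Finset.mem_univ, true_and]
      rw [h0, h2, h1, h3]
      simp [hv.1.eq_iff]
    · ext i; fin_cases i <;> simp [h0, h2]

end Equiv.Perm

/-- The rank of a combination of orthogonal idempotents with nonzero coefficients. -/
lemma Matrix.rank_sum_smul_orthogonal_idempotents {ι κ : Type*} [Fintype ι] [DecidableEq ι]
    [Fintype κ] [DecidableEq κ] (E : κ → Matrix ι ι ℝ) (c : κ → ℝ) (hc : ∀ a, c a ≠ 0)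
    (hE : ∀ a b, E a * E b = if a = b then E a else 0) :
    ((∑ a, c a • E a).rank : ℝ) = ∑ a, (E a).trace := by
  have hmul : ∀ u w : κ → ℝ, (∑ a, u a • E a) * (∑ a, w a • E a) = ∑ a, (u a * w a) • E a := by
    intro u w
    simp [Finset.sum_mul, Finset.mul_sum, hE, smul_smul, mul_comm]
  have h1 : (∑ a, c a • E a) * (∑ a, (c a)⁻¹ • E a) = ∑ a, (1 : ℝ) • E a := by
    rw [hmul]; simp [hc]
  have h2 : (∑ a, (1 : ℝ) • E a) * (∑ a, c a • E a) = ∑ a, c a • E a := by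
    rw [hmul]; simp
  have h3 : (∑ a, (1 : ℝ) • E a) * (∑ a, (1 : ℝ) • E a) = ∑ a, (1 : ℝ) • E a := by
    rw [hmul]; simp
  have hrank : (∑ a, c a • E a).rank = (∑ a, (1 : ℝ) • E a).rank := by
    apply le_antisymm
    · conv_lhs => rw [← h2]
      exact Matrix.rank_mul_le_left _ _
    · rw [← h1]
      exact Matrix.rank_mul_le_left _ _
  have hproj : LinearMap.IsProj (LinearMap.range (Matrix.mulVecLin (∑ a, (1 : ℝ) • E a)))
      (Matrix.mulVecLin (∑ a, (1 : ℝ) • E a)) := by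
    refine ⟨fun v => ⟨v, rfl⟩, ?_⟩
    rintro _ ⟨v, rfl⟩
    simp only [Matrix.mulVecLin_apply, Matrix.mulVec_mulVec, h3]
  have := hproj.trace
  rw [← Matrix.toLin'_apply', Matrix.trace_toLin'_eq] at this
  rw [hrank, Matrix.rank, ← Matrix.toLin'_apply', ← this]
  simp [Matrix.trace_sum]

namespace Equiv.Perm

variable {α : Type*} [Fintype α] [DecidableEq α]

lemma card_fixedFinset_inv (g : Perm α) : (fixedFinset g⁻¹).card = (fixedFinset g).card := by
  congr 1
  ext x
  simp only [fixedFinset, Finset.mem_filter, Finset.mem_univ, true_and,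
    Equiv.Perm.inv_eq_iff_eq]
  exact eq_comm

lemma card_swappedFinset_inv (g : Perm α) :
    (swappedFinset g⁻¹).card = (swappedFinset g).card := by
  congr 1
  ext x
  simp only [swappedFinset, Finset.mem_filter, Finset.mem_univ, true_and, ne_eq,
    Equiv.Perm.inv_eq_iff_eq]
  grind

lemma card_fixedFinset_mul_self (g : Perm α) :
    (fixedFinset (g * g)).card = (fixedFinset g).card + (swappedFinset g).card := by
  rw [← Finset.card_union_of_disjoint]
  · congr 1
    ext x
    simp only [swappedFinset, fixedFinset, Finset.mem_union, Finset.mem_filter, Finset.mem_univ,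
      true_and, Equiv.Perm.mul_apply]
    grind
  · rw [Finset.disjoint_left]
    intro x hx hx'
    simp only [swappedFinset, fixedFinset, Finset.mem_filter, Finset.mem_univ, true_and] at hx hx'
    exact hx'.1 hx

lemma card_fixedFinset_inv_mul (g h : Perm α) :
    ((fixedFinset (g⁻¹ * h)).card : ℝ) =
      Fintype.card α - (Finset.univ.filter fun i => g i ≠ h i).card := by
  have := Finset.card_filter_add_card_filter_not (s := (Finset.univ : Finset α))
    (fun i => g i = h i)
  rw [Finset.card_univ] at this
  have h2 : (fixedFinset (g⁻¹ * h)).card = (Finset.univ.filter fun i => g i = h i).card := by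
    congr 1
    ext x
    simp only [fixedFinset, Finset.mem_filter, Finset.mem_univ, true_and, Equiv.Perm.mul_apply,
      Equiv.Perm.inv_eq_iff_eq]
    exact eq_comm
  rw [h2, ← this]
  push_cast
  ring

lemma isMatrixCharacter_card_fixedFinset (n : ℕ) :
    IsMatrixCharacter fun g : Perm (Fin n) => ((fixedFinset g).card : ℝ) :=
  ⟨Fin n, inferInstance, fun g => Matrix.of fun i j => if g j = i then 1 else 0,
    fun g h => by
      ext i j
      simp only [Matrix.of_apply, Matrix.mul_apply, mul_ite, mul_one, mul_zero,
        Finset.sum_ite_eq, Finset.mem_univ, if_true, Equiv.Perm.mul_apply]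
      congr,
    fun g => by simp [Matrix.trace, fixedFinset]⟩

/-- A polynomial of degree at most four in the numbers `F` of fixed points and `U` of points on
2-cycles (the latter having degree two) is averaged over the permutations of at least three letters
through its expansion in the counting functions of injective tuples. -/
lemma sum_counting_functions (hα : 3 ≤ Fintype.card α) (p : ℝ → ℝ → ℝ)
    (c₀ c₁ c₂ c₃ c₄ b₂ b₃ b₄ b₂₂ : ℝ)
    (hp : ∀ F U, p F U = c₀ + c₁ * F + c₂ * (F * (F - 1)) + c₃ * (F * (F - 1) * (F - 2)) +
      c₄ * (F * (F - 1) * (F - 2) * (F - 3)) + b₂ * U + b₃ * (U * F) +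
      b₄ * (U * (F * (F - 1))) + b₂₂ * (U * U - U * 2)) :
    ∑ g : Perm α, p (fixedFinset g).card (swappedFinset g).card =
      (c₀ + c₁ + c₂ + c₃ + b₂ + b₃ + if 4 ≤ Fintype.card α then c₄ + b₄ + b₂₂ else 0) *
        Fintype.card (Perm α) := by
  have hdesc : ∀ k m : ℕ, (m.descFactorial k : ℝ) = (descPochhammer ℝ k).eval (m : ℝ) :=
    fun k m => (descPochhammer_eval_eq_descFactorial ℝ m k).symm
  have hF : ∀ k, ∑ g : Perm α, (descPochhammer ℝ k).eval ((fixedFinset g).card : ℝ) =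
      if k ≤ Fintype.card α then (Fintype.card (Perm α) : ℝ) else 0 := fun k => by
    have := sum_card_comp_eq (α := α) k 1
    simp only [card_fixed_tuples] at this
    simp only [← hdesc]
    exact_mod_cast this
  have hF1 := hF 1
  have hF2 := hF 2
  have hF3 := hF 3
  have hF4 := hF 4
  have hU2 := congrArg (Nat.cast (R := ℝ)) (sum_card_comp_eq (α := α) 2 (Equiv.swap 0 1))
  have hU3 := congrArg (Nat.cast (R := ℝ)) (sum_card_comp_eq (α := α) 3 (Equiv.swap 0 1))
  have hU4 := congrArg (Nat.cast (R := ℝ)) (sum_card_comp_eq (α := α) 4 (Equiv.swap 0 1))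
  have hU22 := congrArg (Nat.cast (R := ℝ))
    (sum_card_comp_eq (α := α) 4 (Equiv.swap 0 1 * Equiv.swap 2 3))
  have hUU : ∀ g : Perm α, ((Finset.univ.filter fun v : Fin 4 → α => Function.Injective v ∧
      ∀ i, g (v i) = v ((Equiv.swap 0 1 * Equiv.swap 2 3 : Perm (Fin 4)) i)).card : ℝ) =
      (swappedFinset g).card * (swappedFinset g).card - (swappedFinset g).card * 2 := fun g =>
    eq_sub_of_add_eq (by exact_mod_cast card_swapped_swapped_quadruples g)
  simp only [card_swapped_pairs, card_swapped_fixed_triples, card_swapped_fixed_quadruples]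
    at hU2 hU3 hU4
  simp only [Nat.cast_sum, hUU] at hU22
  push_cast [hdesc] at hU2 hU3 hU4 hU22
  simp only [descPochhammer_succ_right, descPochhammer_zero, Polynomial.eval_mul,
    Polynomial.eval_sub, Polynomial.eval_X, Polynomial.eval_one, Polynomial.eval_ofNat,
    one_mul, Nat.cast_zero, Nat.cast_one, sub_zero, Nat.cast_ofNat,
    hα, show 1 ≤ Fintype.card α by lia, show 2 ≤ Fintype.card α by lia, if_true]
    at hF1 hF2 hF3 hF4 hU2 hU3 hU4 hU22
  simp only [hp, Finset.sum_add_distrib, ← Finset.mul_sum, hF1, hF2, hF3, hF4, hU2, hU3, hU4,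
    hU22]
  simp only [Finset.sum_const, Finset.card_univ, nsmul_eq_mul]
  split_ifs <;> ring

end Equiv.Perm

/-- The normalized convolution matrices of orthonormal characters are orthogonal idempotents. -/
lemma IsMatrixCharacter.orthogonal_idempotents {G κ : Type*} [Group G] [Fintype G]
    [DecidableEq κ] {χ : κ → G → ℝ} (hχ : ∀ a, IsMatrixCharacter (χ a))
    (hnorm : ∀ a, χ a 1 ≠ 0 → ∑ g, χ a g⁻¹ * χ a g = Fintype.card G)
    (horth : ∀ a b, a ≠ b → ∑ g, χ a g⁻¹ * χ b g = 0)
    {E : κ → Matrix G G ℝ}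
    (hE : ∀ a, E a = (χ a 1 / Fintype.card G) • Matrix.of fun g h => χ a (g⁻¹ * h)) (a b : κ) :
    E a * E b = if a = b then E a else 0 := by
  have hN : (Fintype.card G : ℝ) ≠ 0 := by simp
  by_cases hb : χ b 1 = 0
  · have : E b = 0 := by rw [hE, hb]; simp
    split_ifs with h
    · rw [h, this, mul_zero]
    · rw [this, mul_zero]
  have hconv : ∀ g h, ∑ k, χ a (g⁻¹ * k) * χ b (k⁻¹ * h) = ∑ m, χ a m⁻¹ * χ b (m * (g⁻¹ * h)) :=
    fun g h => Fintype.sum_equiv ((Equiv.mulLeft g⁻¹).trans (Equiv.inv G)) _ _ fun k => by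
      simp [mul_assoc]
  have hschur := (hχ b).sum_mul_map_mul (hnorm b hb) (f := fun g => χ a g⁻¹)
    (fun g h => by simp only [mul_inv_rev]; exact (hχ a).map_mul_comm _ _)
  ext g h
  have hs := hschur (g⁻¹ * h)
  have hentry : (E a * E b) g h = χ a 1 / Fintype.card G * (χ b 1 / Fintype.card G) *
      ∑ m, χ a m⁻¹ * χ b (m * (g⁻¹ * h)) := by
    simp only [hE, Matrix.mul_apply, Matrix.smul_apply, Matrix.of_apply, smul_eq_mul, ← hconv,
      Finset.mul_sum]
    exact Finset.sum_congr rfl fun _ _ => by ring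
  rw [hentry]
  split_ifs with hab
  · subst hab
    rw [hnorm a hb] at hs
    simp only [hE, Matrix.smul_apply, Matrix.of_apply, smul_eq_mul]
    field_simp
    linear_combination hs
  · rw [horth a b hab, zero_mul] at hs
    rw [(mul_eq_zero.1 hs).resolve_right hb]
    simp

namespace Equiv.Perm

variable {n : ℕ}

/-- The irreducible characters `(n)`, `(n-1,1)`, `(n-2,1,1)` and `(n-2,2)` of the symmetric group
(the last one is zero for `n = 3`). -/
noncomputable def hammingCharacter (n : ℕ) (a : Fin 4) (g : Perm (Fin n)) : ℝ :=
  let F : ℝ := (fixedFinset g).card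
  let U : ℝ := (swappedFinset g).card
  ![1, F - 1, (F ^ 2 - 3 * F + 2 - U) / 2, (F ^ 2 - 3 * F + U) / 2] a

lemma hammingCharacter_inv (a : Fin 4) (g : Perm (Fin n)) :
    hammingCharacter n a g⁻¹ = hammingCharacter n a g := by
  simp only [hammingCharacter, card_fixedFinset_inv, card_swappedFinset_inv]

lemma hammingCharacter_one (a : Fin 4) : hammingCharacter n a 1 =
    ![1, (n : ℝ) - 1, ((n : ℝ) - 1) * (n - 2) / 2, (n : ℝ) * (n - 3) / 2] a := by
  have hF : (fixedFinset (1 : Perm (Fin n))).card = n := by simp [fixedFinset]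
  have hU : (swappedFinset (1 : Perm (Fin n))).card = 0 := by simp [swappedFinset]
  simp only [hammingCharacter, hF, hU]
  fin_cases a <;> simp <;> ring

lemma sum_hammingCharacter_mul_of_lt (hn : 3 ≤ n) {a b : Fin 4} (hab : a < b) :
    ∑ g, hammingCharacter n a g * hammingCharacter n b g = 0 := by
  have S := sum_counting_functions (α := Fin n) (by simpa using hn)
  have h01 := S (fun F U => 1 * (F - 1)) (-1) 1 0 0 0 0 0 0 0 (by intros; ring)
  have h02 := S (fun F U => 1 * ((F ^ 2 - 3 * F + 2 - U) / 2)) 1 (-1) (1 / 2) 0 0 (-1 / 2) 0 0 0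
    (by intros; ring)
  have h03 := S (fun F U => 1 * ((F ^ 2 - 3 * F + U) / 2)) 0 (-1) (1 / 2) 0 0 (1 / 2) 0 0 0
    (by intros; ring)
  have h12 := S (fun F U => (F - 1) * ((F ^ 2 - 3 * F + 2 - U) / 2))
    (-1) 1 (-1 / 2) (1 / 2) 0 (1 / 2) (-1 / 2) 0 0 (by intros; ring)
  have h13 := S (fun F U => (F - 1) * ((F ^ 2 - 3 * F + U) / 2))
    0 0 (-1 / 2) (1 / 2) 0 (-1 / 2) (1 / 2) 0 0 (by intros; ring)
  have h23 := S (fun F U => (F ^ 2 - 3 * F + 2 - U) / 2 * ((F ^ 2 - 3 * F + U) / 2))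
    0 0 0 0 (1 / 4) 0 0 0 (-1 / 4) (by intros; ring)
  norm_num at h01 h02 h03 h12 h13 h23
  fin_cases a <;> fin_cases b <;> first
    | exact absurd hab (by decide)
    | simpa [hammingCharacter]

lemma sum_hammingCharacter_mul_of_ne (hn : 3 ≤ n) {a b : Fin 4} (hab : a ≠ b) :
    ∑ g, hammingCharacter n a g * hammingCharacter n b g = 0 := by
  rcases hab.lt_or_gt with h | h
  · exact sum_hammingCharacter_mul_of_lt hn h
  · simpa only [mul_comm] using sum_hammingCharacter_mul_of_lt hn h

lemma sum_hammingCharacter_mul_self (hn : 3 ≤ n) (a : Fin 4) :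
    ∑ g, hammingCharacter n a g * hammingCharacter n a g =
      if a = 3 ∧ n = 3 then 0 else (Fintype.card (Perm (Fin n)) : ℝ) := by
  have S := sum_counting_functions (α := Fin n) (by simpa using hn)
  have h1 := S (fun F U => (F - 1) * (F - 1)) 1 (-1) 1 0 0 0 0 0 0 (by intros; ring)
  have h2 := S (fun F U => (F ^ 2 - 3 * F + 2 - U) / 2 * ((F ^ 2 - 3 * F + 2 - U) / 2))
    1 (-1) (1 / 2) 0 (1 / 4) (-1 / 2) 1 (-1 / 2) (1 / 4) (by intros; ring)
  have h3 := S (fun F U => (F ^ 2 - 3 * F + U) / 2 * ((F ^ 2 - 3 * F + U) / 2))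
    0 1 (-1 / 2) 0 (1 / 4) (1 / 2) (-1) (1 / 2) (1 / 4) (by intros; ring)
  norm_num only [Fintype.card_fin, ite_self, add_zero, zero_add] at h1 h2 h3
  fin_cases a
  · simp [hammingCharacter]
  · simpa [hammingCharacter] using h1
  · simpa [hammingCharacter] using h2
  · rcases hn.eq_or_lt with h | h
    · subst h
      simpa [hammingCharacter] using h3
    · rw [if_pos (Nat.succ_le_of_lt h), one_mul] at h3
      rw [if_neg (by lia)]
      simpa [hammingCharacter] using h3

lemma isMatrixCharacter_hammingCharacter (hn : 3 ≤ n) (a : Fin 4) :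
    IsMatrixCharacter (hammingCharacter n a) := by
  have S := sum_counting_functions (α := Fin n) (by simpa using hn)
  have h0 : IsMatrixCharacter (hammingCharacter n 0) := by
    have : hammingCharacter n 0 = fun _ => 1 := by
      funext g
      simp [hammingCharacter]
    rw [this]
    exact IsMatrixCharacter.one
  have hnorm : ∀ a : Fin 4, a ≠ 3 → ∑ g, hammingCharacter n a g⁻¹ * hammingCharacter n a g =
      Fintype.card (Perm (Fin n)) := fun a ha => by
    simp only [hammingCharacter_inv, sum_hammingCharacter_mul_self hn, ha, false_and, if_false]
  have h1 : IsMatrixCharacter (hammingCharacter n 1) := by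
    refine (isMatrixCharacter_card_fixedFinset n).sub h0 (hnorm 0 (by decide)) ?_
    have := S (fun F U => F * 1) 0 1 0 0 0 0 0 0 0 (by intros; ring)
    simpa [hammingCharacter, card_fixedFinset_inv] using this
  have hsq : ∀ ε : ℝ,
      (fun g => (hammingCharacter n 1 g ^ 2 + ε * hammingCharacter n 1 (g * g)) / 2) =
      fun g => (((fixedFinset g).card - 1 : ℝ) ^ 2 +
        ε * ((fixedFinset g).card + (swappedFinset g).card - 1)) / 2 := fun ε => by
    funext g
    simp [hammingCharacter, card_fixedFinset_mul_self]
  have h2 : IsMatrixCharacter (hammingCharacter n 2) := by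
    have := h1.half_sq (ε := -1) (by norm_num)
    rw [hsq] at this
    convert this using 2 with g
    simp [hammingCharacter]
    ring
  have h3 : IsMatrixCharacter (hammingCharacter n 3) := by
    have := h1.half_sq (ε := 1) (by norm_num)
    rw [hsq] at this
    have := (this.sub h0 (hnorm 0 (by decide)) ?_).sub h1 (hnorm 1 (by decide)) ?_
    · convert this using 2 with g
      simp [hammingCharacter]
      ring
    · have := S (fun F U => ((F - 1) ^ 2 + 1 * (F + U - 1)) / 2 * 1)
        0 0 (1 / 2) 0 0 (1 / 2) 0 0 0 (by intros; ring)
      norm_num only [ite_self, add_zero, zero_add, one_mul] at this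
      simpa [hammingCharacter, card_fixedFinset_inv, card_swappedFinset_inv] using this
    · have := S (fun F U => (((F - 1) ^ 2 + 1 * (F + U - 1)) / 2 - 1) * (F - 1))
        1 (-1) (1 / 2) (1 / 2) 0 (-1 / 2) (1 / 2) 0 0 (by intros; ring)
      norm_num only [ite_self, add_zero, zero_add, one_mul] at this
      simpa [hammingCharacter, card_fixedFinset_inv, card_swappedFinset_inv] using this
  fin_cases a
  exacts [h0, h1, h2, h3]

end Equiv.Perm

open Equiv.Perm in
/-- For `n ≥ 3`, the centered MDS matrix
`M = −(1/2) H (D ∘ D) H` of the symmetric group `S_n` with the Hamming distance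
`d_H(g, h) = #{i : g i ≠ h i}` has rank `(n−1)² + ((n−1)(n−2)/2)² + (n(n−3)/2)²`. -/
theorem mds_rank_hamming_symmetric_group (n : ℕ) (hn : 3 ≤ n)
    (D : Matrix (Equiv.Perm (Fin n)) (Equiv.Perm (Fin n)) ℝ)
    (hD : ∀ g h : Equiv.Perm (Fin n),
      D g h = ((Finset.univ.filter fun i => g i ≠ h i).card : ℝ))
    (H : Matrix (Equiv.Perm (Fin n)) (Equiv.Perm (Fin n)) ℝ)
    (hH : H = 1 - (Fintype.card (Equiv.Perm (Fin n)) : ℝ)⁻¹ • Matrix.of fun _ _ => (1 : ℝ))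
    (M : Matrix (Equiv.Perm (Fin n)) (Equiv.Perm (Fin n)) ℝ)
    (hM : M = (-(1/2 : ℝ)) • (H * (Matrix.hadamard D D) * H)) :
    M.rank = (n - 1) ^ 2 + ((n - 1) * (n - 2) / 2) ^ 2 + (n * (n - 3) / 2) ^ 2 := by
  set N : ℝ := (Fintype.card (Equiv.Perm (Fin n)) : ℝ) with hNdef
  have hN : N ≠ 0 := by simp [hNdef]
  have hn' : (3 : ℝ) ≤ n := by exact_mod_cast hn
  set d : Fin 4 → ℝ := fun a => hammingCharacter n a 1 with hd
  have hd_ne : ∀ a, (a = 3 ∧ n = 3) ∨ d a ≠ 0 := by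
    intro a
    simp only [hd, hammingCharacter_one]
    fin_cases a
    · simp
    · right; simp; linarith
    · right; simp; constructor <;> linarith
    · rcases hn.eq_or_lt with h | h
      · left; exact ⟨rfl, h.symm⟩
      · have : (3 : ℝ) < n := by exact_mod_cast h
        right; simp; constructor
        · lia
        · linarith
  set E : Fin 4 → Matrix (Equiv.Perm (Fin n)) (Equiv.Perm (Fin n)) ℝ := fun a =>
    (d a / N) • Matrix.of fun g h => hammingCharacter n a (g⁻¹ * h) with hE
  have hEE : ∀ a b, E a * E b = if a = b then E a else 0 :=
    IsMatrixCharacter.orthogonal_idempotents (isMatrixCharacter_hammingCharacter hn)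
      (fun a ha => by
        simp only [hammingCharacter_inv, sum_hammingCharacter_mul_self hn]
        rw [if_neg]
        rintro ⟨rfl, rfl⟩
        exact ha (by simp [hammingCharacter_one]))
      (fun a b hab => by
        simp only [hammingCharacter_inv, sum_hammingCharacter_mul_of_ne hn hab])
      (fun a => rfl)
  set w : Fin 4 → ℝ := fun a => if d a = 0 then 1 else N / d a with hw
  have hw_ne : ∀ a, w a ≠ 0 := by
    intro a
    simp only [hw]
    split_ifs with h
    · exact one_ne_zero
    · exact div_ne_zero hN h
  have hwE : ∀ a g h, w a * E a g h = hammingCharacter n a (g⁻¹ * h) := by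
    intro a g h
    rcases hd_ne a with ⟨rfl, rfl⟩ | ha
    · have hnorm := sum_hammingCharacter_mul_self (n := 3) le_rfl 3
      rw [if_pos ⟨rfl, rfl⟩, Finset.sum_eq_zero_iff_of_nonneg fun _ _ => mul_self_nonneg _] at hnorm
      have hzero : ∀ k, hammingCharacter 3 3 k = 0 := fun k =>
        mul_self_eq_zero.1 (hnorm k (Finset.mem_univ _))
      simp [hE, hzero]
    · simp only [hw, if_neg ha, hE, Matrix.smul_apply, Matrix.of_apply, smul_eq_mul]
      field_simp
  have hDD : Matrix.hadamard D D = (((n : ℝ) ^ 2 - 2 * n + 2) * w 0) • E 0 +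
      ((3 - 2 * (n : ℝ)) * w 1) • E 1 + w 2 • E 2 + w 3 • E 3 := by
    ext g h
    simp only [Matrix.hadamard_apply, Matrix.add_apply, Matrix.smul_apply, smul_eq_mul, mul_assoc,
      hwE]
    have : D g h = n - (fixedFinset (g⁻¹ * h)).card := by
      rw [card_fixedFinset_inv_mul, ← hD, Fintype.card_fin]; ring
    rw [this]
    simp [hammingCharacter]
    ring
  have hH0 : H = 1 - E 0 := by
    rw [hH, hE]
    congr 1
    ext g h
    simp [hd, hammingCharacter]
  set c : Fin 3 → ℝ := ![-(1 / 2) * ((3 - 2 * (n : ℝ)) * w 1), -(1 / 2) * w 2, -(1 / 2) * w 3]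
    with hc
  have hME : M = ∑ a, c a • E (Fin.succ a) := by
    rw [hM, hDD, hH0]
    simp [Fin.sum_univ_three, hc, sub_mul, mul_sub, add_mul, mul_add, hEE, smul_smul]
  have hc_ne : ∀ a, c a ≠ 0 := by
    have h3 : (3 - 2 * (n : ℝ)) ≠ 0 := by linarith
    intro a
    fin_cases a <;> simp [hc, hw_ne, h3]
  have htr : ∀ a, (E a).trace = d a ^ 2 := by
    intro a
    simp [hE, Matrix.trace, ← hNdef]
    field_simp
    exact (sq (d a)).symm
  have hrank := Matrix.rank_sum_smul_orthogonal_idempotents (fun a => E (Fin.succ a)) c hc_ne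
    (fun a b => by simp [hEE])
  rw [← hME] at hrank
  simp only [htr, Fin.sum_univ_three, hd, hammingCharacter_one] at hrank
  obtain ⟨m, rfl⟩ := Nat.exists_eq_add_of_le hn
  obtain ⟨r, hr⟩ := (Nat.even_mul_succ_self (m + 1)).two_dvd
  obtain ⟨s, hs⟩ : 2 ∣ (3 + m) * m := by
    rcases Nat.even_or_odd m with h | h
    · exact h.two_dvd.mul_left _
    · exact ((by decide : Odd 3).add_odd h).two_dvd.mul_right _
  have e1 : 3 + m - 1 = m + 2 := by lia
  have e2 : (m + 2) * (3 + m - 2) / 2 = r := by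
    rw [show 3 + m - 2 = m + 1 by lia, mul_comm]; lia
  have e3 : (3 + m) * (3 + m - 3) / 2 = s := by
    rw [show 3 + m - 3 = m by lia]; lia
  rw [e1, e2, e3]
  have hr' : ((m : ℝ) + 1) * (m + 1 + 1) = 2 * r := by exact_mod_cast hr
  have hs' : (3 + (m : ℝ)) * m = 2 * s := by exact_mod_cast hs
  have f2 : ((3 + m : ℝ) - 1) * ((3 + m) - 2) / 2 = r := by linarith
  have f3 : ((3 + m : ℝ)) * ((3 + m) - 3) / 2 = s := by linarith
  have : (M.rank : ℝ) = ((m + 2) ^ 2 + r ^ 2 + s ^ 2 : ℕ) := by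
    push_cast at hrank ⊢
    rw [← f2, ← f3]
    refine hrank.trans ?_
    simp
    ring
  exact_mod_cast this
end

section
/- Let n ≥ 4, let X = S_n with the Hamming distance d_H(g, h) = #{i : g(i) ≠ h(i)}, and let M = −(1/2)·H (D ∘ D) H be the centered MDS matrix of this finite metric space. Then (2n−3)·n!/(2n−2) is an eigenvalue of M and its eigenspace has dimension exactly (n−1)². -/
open Equiv Finset Matrix

namespace HammingMDS

variable {α : Type*} [Fintype α] [DecidableEq α]

/-- The `k`-th factorial moment of the number of fixed points, by Burnside's lemma applied to
the transitive action of `Perm α` on injections `Fin k ↪ α`. -/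
theorem sum_descFactorial_card_fixed {k : ℕ} (hk : k ≤ Fintype.card α) :
    ∑ s : Perm α, (#{i | s i = i}).descFactorial k = (Fintype.card α).factorial := by
  classical
  have : MulAction.IsPretransitive (Perm α) (Fin k ↪ α) :=
    Equiv.Perm.isMultiplyPretransitive α k
  have : Nonempty (Fin k ↪ α) := Function.Embedding.nonempty_of_card_le (by simpa)
  have : Fintype (MulAction.orbitRel.Quotient (Perm α) (Fin k ↪ α)) := Fintype.ofFinite _
  have burnside := MulAction.sum_card_fixedBy_eq_card_orbits_mul_card_group (Perm α) (Fin k ↪ α)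
  have orbits : Fintype.card (MulAction.orbitRel.Quotient (Perm α) (Fin k ↪ α)) = 1 :=
    Fintype.card_eq_one_iff_nonempty_unique.2 <|
      (MulAction.pretransitive_iff_unique_quotient_of_nonempty (Perm α) (Fin k ↪ α)).1 inferInstance
  rw [orbits, one_mul, Fintype.card_perm] at burnside
  rw [← burnside]
  refine Finset.sum_congr rfl fun s _ => ?_
  have e : MulAction.fixedBy (Fin k ↪ α) s ≃ (Fin k ↪ {i // s i = i}) :=
    { toFun := fun x => ⟨fun j => ⟨x.1 j, DFunLike.congr_fun x.2 j⟩,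
        fun a b h => x.1.injective (congrArg Subtype.val h)⟩
      invFun := fun y => ⟨y.trans (Function.Embedding.subtype _), by ext j; exact (y j).2⟩
      left_inv := fun x => rfl
      right_inv := fun y => rfl }
  rw [Fintype.card_congr e, Fintype.card_embedding_eq, Fintype.card_fin, Fintype.card_subtype]

/-- The number of fixed points of a permutation, as a real number: the permutation character. -/
def fixChar (s : Perm α) : ℝ := #{i | s i = i}

theorem fixChar_eq_sum (s : Perm α) : fixChar s = ∑ i, if s i = i then (1 : ℝ) else 0 := by
  simp [fixChar]

theorem fixChar_conj (p s : Perm α) : fixChar (p * s * p⁻¹) = fixChar s := by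
  rw [fixChar_eq_sum, fixChar_eq_sum, ← Equiv.sum_comp p]
  simp

theorem fixChar_inv (s : Perm α) : fixChar s⁻¹ = fixChar s := by
  simp only [fixChar, Perm.inv_eq_iff_eq]
  simp [eq_comm]

theorem fixChar_inv_mul (g h : Perm α) :
    fixChar (g⁻¹ * h) = ∑ i, if g i = h i then (1 : ℝ) else 0 := by
  simp only [fixChar_eq_sum, Perm.mul_apply, Perm.inv_eq_iff_eq, eq_comm (a := g _)]

theorem sum_fixChar (h : 1 ≤ Fintype.card α) :
    ∑ s : Perm α, fixChar s = (Fintype.card α).factorial := by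
  have h1 := sum_descFactorial_card_fixed h
  simp only [Nat.descFactorial_one] at h1
  simp only [fixChar]
  exact_mod_cast h1

theorem sum_fixChar_sq (h : 2 ≤ Fintype.card α) :
    ∑ s : Perm α, fixChar s ^ 2 = 2 * (Fintype.card α).factorial := by
  have h2 := sum_descFactorial_card_fixed h
  have key : ∀ c : ℕ, (c : ℝ) ^ 2 = (c.descFactorial 2 : ℕ) + c := fun c => by
    rw [Nat.cast_descFactorial_two]; ring
  have h1 := sum_fixChar (α := α) (by lia)
  simp only [fixChar] at h1 ⊢
  rw [Finset.sum_congr rfl fun s _ => key _, Finset.sum_add_distrib]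
  rw [h1, ← Nat.cast_sum, h2]
  ring

theorem sum_fixChar_cube (h : 3 ≤ Fintype.card α) :
    ∑ s : Perm α, fixChar s ^ 3 = 5 * (Fintype.card α).factorial := by
  have h3 := sum_descFactorial_card_fixed h
  have key : ∀ c : ℕ, (c : ℝ) ^ 3 = (c.descFactorial 3 : ℕ) + 3 * (c : ℝ) ^ 2 - 2 * c := by
    rintro (_ | _ | _ | c)
    · simp
    · norm_num [Nat.descFactorial]
    · norm_num [Nat.descFactorial]
    · simp only [Nat.descFactorial]
      push_cast [Nat.add_sub_cancel, show c + 1 + 1 + 1 - 2 = c + 1 by lia,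
        show c + 1 + 1 + 1 - 1 = c + 2 by lia, show c + 1 + 1 + 1 - 0 = c + 3 by lia]
      ring
  have h1 := sum_fixChar (α := α) (by lia)
  have h2 := sum_fixChar_sq (α := α) (by lia)
  simp only [fixChar] at h1 h2 ⊢
  rw [Finset.sum_congr rfl fun s _ => key _, Finset.sum_sub_distrib, Finset.sum_add_distrib,
    ← Finset.mul_sum, ← Finset.mul_sum]
  rw [h1, h2, ← Nat.cast_sum, h3]
  ring

/-- For a class function `f`, the sum of `f` over the permutations sending `k` to `l` depends only
on whether `k = l`. -/
theorem exists_sum_ite_apply_eq (f : Perm α → ℝ) (hf : ∀ p s, f (p * s * p⁻¹) = f s) :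
    ∃ a b : ℝ, ∀ k l : α, ∑ s : Perm α, (if s k = l then f s else 0) = if k = l then a else b := by
  have conj (p : Perm α) (k l : α) : ∑ s : Perm α, (if s (p k) = p l then f s else 0) =
      ∑ s : Perm α, if s k = l then f s else 0 := by
    rw [← Equiv.sum_comp (MulAut.conj p).toEquiv]
    simp [hf]
  have diag : ∃ a : ℝ, ∀ k : α, ∑ s : Perm α, (if s k = k then f s else 0) = a := by
    rcases isEmpty_or_nonempty α with h | ⟨⟨k₀⟩⟩
    · exact ⟨0, fun k => h.elim k⟩
    · exact ⟨∑ s : Perm α, (if s k₀ = k₀ then f s else 0), fun k => by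
        simpa using conj (Equiv.swap k₀ k) k₀ k₀⟩
  have offDiag : ∃ b : ℝ, ∀ k l : α, k ≠ l → ∑ s : Perm α, (if s k = l then f s else 0) = b := by
    by_cases h : ∃ k₀ l₀ : α, k₀ ≠ l₀
    · obtain ⟨k₀, l₀, h₀⟩ := h
      refine ⟨∑ s : Perm α, (if s k₀ = l₀ then f s else 0), fun k l hkl => ?_⟩
      obtain ⟨p, rfl, rfl⟩ := MulAction.is_two_pretransitive_iff.1
        (Equiv.Perm.isMultiplyPretransitive α 2) h₀ hkl
      exact conj p k₀ l₀
    · exact ⟨0, fun k l hkl => (h ⟨k, l, hkl⟩).elim⟩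
  obtain ⟨a, ha⟩ := diag
  obtain ⟨b, hb⟩ := offDiag
  refine ⟨a, b, fun k l => ?_⟩
  split_ifs with h
  · exact h ▸ ha k
  · exact hb k l h

/-- The convolution of the permutation character with a class function. -/
theorem sum_fixChar_mul_classFunction (h : 2 ≤ Fintype.card α) (f : Perm α → ℝ)
    (hf : ∀ p s, f (p * s * p⁻¹) = f s) (x : Perm α) :
    ((Fintype.card α : ℝ) - 1) * ∑ s : Perm α, fixChar (x * s⁻¹) * f s =
      (∑ s, fixChar s * f s - ∑ s, f s) * fixChar x +
        (Fintype.card α * ∑ s, f s - ∑ s, fixChar s * f s) := by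
  obtain ⟨a, b, hab⟩ := exists_sum_ite_apply_eq f hf
  have conv : ∑ s : Perm α, fixChar (x * s⁻¹) * f s =
      (a - b) * fixChar x + Fintype.card α * b := by
    calc ∑ s : Perm α, fixChar (x * s⁻¹) * f s
        = ∑ s : Perm α, ∑ m, if s m = x m then f s else 0 := by
          refine Finset.sum_congr rfl fun s _ => ?_
          rw [fixChar_eq_sum, ← Equiv.sum_comp s, Finset.sum_mul]
          simp [eq_comm]
      _ = ∑ m, if m = x m then a else b := by
          rw [Finset.sum_comm]; exact Finset.sum_congr rfl fun m _ => hab m (x m)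
      _ = ∑ m, ((a - b) * (if x m = m then 1 else 0) + b) := by
          refine Finset.sum_congr rfl fun m _ => ?_
          by_cases hm : x m = m
          · simp [hm]
          · simp [hm, Ne.symm hm]
      _ = _ := by
          rw [Finset.sum_add_distrib, ← Finset.mul_sum, ← fixChar_eq_sum]; simp
  have diag : ∑ s : Perm α, fixChar s * f s = Fintype.card α * a := by
    calc ∑ s : Perm α, fixChar s * f s = ∑ s : Perm α, ∑ m, if s m = m then f s else 0 := by
          refine Finset.sum_congr rfl fun s _ => ?_
          rw [fixChar_eq_sum, Finset.sum_mul]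
          simp
      _ = _ := by rw [Finset.sum_comm]; simp [hab]
  obtain ⟨k⟩ : Nonempty α := Fintype.card_pos_iff.1 (by lia)
  have total : ∑ s : Perm α, f s = a + (Fintype.card α - 1) * b := by
    calc ∑ s : Perm α, f s = ∑ s : Perm α, ∑ l, if s k = l then f s else 0 := by simp
      _ = ∑ l, ((a - b) * (if k = l then 1 else 0) + b) := by
          rw [Finset.sum_comm]
          refine Finset.sum_congr rfl fun l _ => ?_
          rw [hab]
          split_ifs <;> simp
      _ = _ := by
          rw [Finset.sum_add_distrib, ← Finset.mul_sum]; simp; ring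
  rw [conv, diag, total]
  ring

/-- The matrix `(g, h) ↦ f (g⁻¹ h)` of right convolution by `f`. -/
def convMatrix (f : Perm α → ℝ) : Matrix (Perm α) (Perm α) ℝ := Matrix.of fun g h => f (g⁻¹ * h)

theorem convMatrix_mul_apply (f f' : Perm α → ℝ) (g k : Perm α) :
    (convMatrix f * convMatrix f') g k = ∑ s, f (g⁻¹ * k * s⁻¹) * f' s := by
  rw [Matrix.mul_apply, ← Equiv.sum_comp ((Equiv.inv (Perm α)).trans (Equiv.mulLeft k))]
  simp [convMatrix, mul_assoc]

/-- The all-ones matrix. -/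
def onesMatrix : Matrix (Perm α) (Perm α) ℝ := Matrix.of fun _ _ => 1

theorem onesMatrix_mul_convMatrix (f : Perm α → ℝ) :
    onesMatrix * convMatrix f = (∑ s, f s) • onesMatrix := by
  ext g k
  rw [Matrix.mul_apply, Matrix.smul_apply,
    ← Equiv.sum_comp ((Equiv.inv (Perm α)).trans (Equiv.mulLeft k))]
  simp [convMatrix, onesMatrix]

theorem convMatrix_mul_onesMatrix (f : Perm α → ℝ) :
    convMatrix f * onesMatrix = (∑ s, f s) • onesMatrix := by
  ext g k
  rw [Matrix.mul_apply, Matrix.smul_apply, ← Equiv.sum_comp (Equiv.mulLeft g)]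
  simp [convMatrix, onesMatrix]

theorem onesMatrix_mul_onesMatrix :
    onesMatrix * onesMatrix = ((Fintype.card α).factorial : ℝ) • onesMatrix (α := α) := by
  ext g k
  simp [Matrix.mul_apply, onesMatrix, Fintype.card_perm]

theorem convMatrix_transpose {β : Type*} (f : Perm β → ℝ) (hf : ∀ s, f s⁻¹ = f s) :
    (convMatrix f)ᵀ = convMatrix f := by
  ext g h
  simp [convMatrix, ← hf (h⁻¹ * g)]

theorem convMatrix_fixChar_mul_convMatrix (h : 2 ≤ Fintype.card α) (f : Perm α → ℝ)
    (hf : ∀ p s, f (p * s * p⁻¹) = f s) :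
    ((Fintype.card α : ℝ) - 1) • (convMatrix fixChar * convMatrix f) =
      (∑ s, fixChar s * f s - ∑ s, f s) • convMatrix fixChar +
        (Fintype.card α * ∑ s, f s - ∑ s, fixChar s * f s) • onesMatrix := by
  ext g k
  simp only [Matrix.smul_apply, Matrix.add_apply, convMatrix_mul_apply, smul_eq_mul]
  rw [sum_fixChar_mul_classFunction h f hf]
  simp [convMatrix, onesMatrix]

theorem posSemidef_convMatrix_fixChar : (convMatrix (fixChar (α := α))).PosSemidef := by
  let A : Matrix (Perm α) (α × α) ℝ := Matrix.of fun g p => if g p.1 = p.2 then 1 else 0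
  have hA : convMatrix (fixChar (α := α)) = A * Aᴴ := by
    ext g h
    simp [convMatrix, A, Matrix.mul_apply, Fintype.sum_prod_type, fixChar_inv_mul, eq_comm]
  rw [hA]
  exact Matrix.posSemidef_self_mul_conjTranspose A

theorem posSemidef_convMatrix_fixChar_sq :
    (convMatrix fun s : Perm α => fixChar s ^ 2).PosSemidef := by
  have hsq : (convMatrix fun s : Perm α => fixChar s ^ 2) =
      (convMatrix fixChar).hadamard (convMatrix fixChar) := by
    ext g h
    simp [convMatrix, sq]
  rw [hsq]
  exact posSemidef_convMatrix_fixChar.hadamard posSemidef_convMatrix_fixChar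

/-- The matrix of right convolution by the character of the standard representation. -/
def stdMatrix : Matrix (Perm α) (Perm α) ℝ := convMatrix fixChar - onesMatrix

theorem stdMatrix_mul_self (h : 2 ≤ Fintype.card α) :
    stdMatrix * stdMatrix =
      ((Fintype.card α).factorial / (Fintype.card α - 1) : ℝ) • stdMatrix (α := α) := by
  have hn : ((Fintype.card α : ℝ) - 1) ≠ 0 := by
    have : (2 : ℝ) ≤ Fintype.card α := by exact_mod_cast h
    linarith
  have hFF := convMatrix_fixChar_mul_convMatrix h fixChar fixChar_conj
  simp only [← sq (fixChar _), sum_fixChar_sq h, sum_fixChar (α := α) (by lia)] at hFF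
  refine smul_right_injective _ hn ?_
  simp only [stdMatrix, mul_sub, sub_mul, smul_sub, smul_smul, mul_div_cancel₀ _ hn,
    convMatrix_mul_onesMatrix, onesMatrix_mul_convMatrix, onesMatrix_mul_onesMatrix,
    sum_fixChar (α := α) (by lia)]
  rw [hFF]
  module

theorem convMatrix_fixChar_sq_mul_stdMatrix (h : 3 ≤ Fintype.card α) :
    (convMatrix fun s => fixChar s ^ 2) * stdMatrix =
      (3 * ((Fintype.card α).factorial / (Fintype.card α - 1)) : ℝ) • stdMatrix (α := α) := by
  have hn : ((Fintype.card α : ℝ) - 1) ≠ 0 := by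
    have : (3 : ℝ) ≤ Fintype.card α := by exact_mod_cast h
    linarith
  have hFQ := convMatrix_fixChar_mul_convMatrix (by lia) (fun s : Perm α => fixChar s ^ 2)
    fun p s => by rw [fixChar_conj]
  simp only [← pow_succ', sum_fixChar_sq (α := α) (by lia), sum_fixChar_cube h] at hFQ
  have hQF := congrArg Matrix.transpose hFQ
  have hones : (onesMatrix (α := α))ᵀ = onesMatrix := rfl
  simp only [Matrix.transpose_smul, Matrix.transpose_mul, Matrix.transpose_add, hones,
    convMatrix_transpose fixChar fixChar_inv,
    convMatrix_transpose (fun s : Perm α => fixChar s ^ 2) fun s => by rw [fixChar_inv]] at hQF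
  refine smul_right_injective _ hn ?_
  simp only [stdMatrix, mul_sub, smul_sub, smul_smul, convMatrix_mul_onesMatrix,
    sum_fixChar_sq (α := α) (by lia)]
  rw [hQF, show ((Fintype.card α : ℝ) - 1) *
    (3 * ((Fintype.card α).factorial / (Fintype.card α - 1))) = 3 * (Fintype.card α).factorial by
      field_simp]
  module

theorem onesMatrix_mul_stdMatrix (h : 1 ≤ Fintype.card α) :
    onesMatrix * stdMatrix (α := α) = 0 := by
  rw [stdMatrix, mul_sub, onesMatrix_mul_convMatrix, onesMatrix_mul_onesMatrix, sum_fixChar h,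
    sub_self]

theorem trace_stdMatrix :
    (stdMatrix (α := α)).trace = (Fintype.card α - 1) * (Fintype.card α).factorial := by
  simp [stdMatrix, convMatrix, onesMatrix, Matrix.trace, fixChar, Fintype.card_perm]
  ring

/-- Double centering of the squared Hamming distance matrix. -/
theorem centered_sq_hamming_eq (h : 2 ≤ Fintype.card α) :
    (-(1 / 2 : ℝ)) • ((1 - ((Fintype.card α).factorial : ℝ)⁻¹ • onesMatrix) *
      (((Fintype.card α : ℝ) ^ 2) • onesMatrix - (2 * (Fintype.card α : ℝ)) • convMatrix fixChar +
        convMatrix fun s => fixChar s ^ 2) *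
      (1 - ((Fintype.card α).factorial : ℝ)⁻¹ • onesMatrix)) =
    (Fintype.card α : ℝ) • stdMatrix (α := α) -
      (1 / 2 : ℝ) • (convMatrix fun s => fixChar s ^ 2) + onesMatrix := by
  have hN : ((Fintype.card α).factorial : ℝ) ≠ 0 := by positivity
  simp only [stdMatrix, mul_sub, sub_mul, mul_add, add_mul, one_mul, mul_one, smul_mul_assoc,
    mul_smul_comm, onesMatrix_mul_onesMatrix, onesMatrix_mul_convMatrix, convMatrix_mul_onesMatrix,
    sum_fixChar_sq h, sum_fixChar (α := α) (by lia)]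
  match_scalars <;> field_simp
  ring

/-- The normalized standard character matrix projects onto the top eigenspace. -/
theorem isProj_eigenspace (h : 3 ≤ Fintype.card α) (M : Matrix (Perm α) (Perm α) ℝ)
    (hM : M = (Fintype.card α : ℝ) • stdMatrix (α := α) -
      (1 / 2 : ℝ) • (convMatrix fun s => fixChar s ^ 2) + onesMatrix) :
    LinearMap.IsProj (Module.End.eigenspace M.mulVecLin
        ((2 * (Fintype.card α : ℝ) - 3) * (Fintype.card α).factorial /
          (2 * (Fintype.card α : ℝ) - 2)))
      (((Fintype.card α - 1) / (Fintype.card α).factorial : ℝ) • stdMatrix (α := α)).mulVecLin := by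
  have hn : (3 : ℝ) ≤ Fintype.card α := by exact_mod_cast h
  have hN : (0 : ℝ) < (Fintype.card α).factorial := by positivity
  have hn1 : (Fintype.card α : ℝ) - 1 ≠ 0 := by linarith
  have hn2 : 2 * (Fintype.card α : ℝ) - 2 ≠ 0 := by linarith
  set n : ℝ := (Fintype.card α : ℝ)
  set N : ℝ := ((Fintype.card α).factorial : ℝ)
  set μ : ℝ := (2 * n - 3) * N / (2 * n - 2) with hμ
  have hμ_pos : 0 < μ := div_pos (mul_pos (by linarith) hN) (by linarith)
  set P : Matrix (Perm α) (Perm α) ℝ := ((n - 1) / N) • stdMatrix with hP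
  have hGG : stdMatrix * stdMatrix = (N / (n - 1)) • stdMatrix (α := α) :=
    stdMatrix_mul_self (by lia)
  have hQG : (convMatrix fun s => fixChar s ^ 2) * stdMatrix =
      (3 * (N / (n - 1))) • stdMatrix (α := α) := convMatrix_fixChar_sq_mul_stdMatrix h
  have hMP : M * P = μ • P := by
    rw [hP, mul_smul_comm, smul_comm μ]
    congr 1
    rw [hM, add_mul, sub_mul, smul_mul_assoc, smul_mul_assoc, hGG, hQG,
      onesMatrix_mul_stdMatrix (by lia), add_zero, smul_smul, smul_smul, ← sub_smul]
    congr 1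
    rw [hμ, show 2 * n - 2 = 2 * (n - 1) by ring]
    field_simp
  have hGP : stdMatrix * P = stdMatrix := by
    rw [hP, mul_smul_comm, hGG, smul_smul, div_mul_div_cancel₀ hN.ne', div_self hn1, one_smul]
  have hJP : onesMatrix * P = 0 := by
    rw [hP, mul_smul_comm, onesMatrix_mul_stdMatrix (by lia), smul_zero]
  have hJM : onesMatrix * M = 0 := by
    rw [hM, mul_add, mul_sub, mul_smul_comm, mul_smul_comm, onesMatrix_mul_stdMatrix (by lia),
      onesMatrix_mul_convMatrix, onesMatrix_mul_onesMatrix, sum_fixChar_sq (by lia)]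
    module
  refine ⟨fun x => ?_, fun v hv => ?_⟩
  · rw [Module.End.mem_eigenspace_iff]
    simp only [Matrix.mulVecLin_apply, Matrix.mulVec_mulVec, hMP, Matrix.smul_mulVec]
  · rw [Module.End.mem_eigenspace_iff, Matrix.mulVecLin_apply] at hv
    rw [Matrix.mulVecLin_apply]
    set u := v - P *ᵥ v with hu
    have hMu : M *ᵥ u = μ • u := by
      rw [hu, Matrix.mulVec_sub, hv, Matrix.mulVec_mulVec, hMP, Matrix.smul_mulVec, smul_sub]
    have hGu : stdMatrix *ᵥ u = 0 := by
      rw [hu, Matrix.mulVec_sub, Matrix.mulVec_mulVec, hGP, sub_self]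
    have hJu : onesMatrix *ᵥ u = 0 := by
      have : μ • (onesMatrix *ᵥ u) = 0 := by
        rw [← Matrix.mulVec_smul, ← hMu, Matrix.mulVec_mulVec, hJM, Matrix.zero_mulVec]
      exact (smul_eq_zero.1 this).resolve_left hμ_pos.ne'
    have hQu := posSemidef_convMatrix_fixChar_sq.dotProduct_mulVec_nonneg u
    have hsum : μ * (u ⬝ᵥ u) =
        -(1 / 2) * (u ⬝ᵥ (convMatrix fun s : Perm α => fixChar s ^ 2) *ᵥ u) := by
      rw [← smul_eq_mul μ, ← dotProduct_smul, ← hMu, hM, Matrix.add_mulVec, Matrix.sub_mulVec,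
        Matrix.smul_mulVec, Matrix.smul_mulVec, hGu, hJu]
      simp
    rw [star_trivial] at hQu
    have hsq : 0 ≤ u ⬝ᵥ u := Finset.sum_nonneg fun i _ => mul_self_nonneg (u i)
    have hu0 : u ⬝ᵥ u = 0 := by nlinarith
    rw [dotProduct_self_eq_zero, hu, sub_eq_zero] at hu0
    exact hu0.symm

theorem finrank_eigenspace (h : 3 ≤ Fintype.card α) (M : Matrix (Perm α) (Perm α) ℝ)
    (hM : M = (Fintype.card α : ℝ) • stdMatrix (α := α) -
      (1 / 2 : ℝ) • (convMatrix fun s => fixChar s ^ 2) + onesMatrix) :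
    Module.finrank ℝ (Module.End.eigenspace M.mulVecLin
        ((2 * (Fintype.card α : ℝ) - 3) * (Fintype.card α).factorial /
          (2 * (Fintype.card α : ℝ) - 2))) = (Fintype.card α - 1) ^ 2 := by
  have htr := (isProj_eigenspace h M hM).trace
  rw [← Matrix.toLin'_apply', Matrix.trace_toLin'_eq, Matrix.trace_smul, trace_stdMatrix] at htr
  have hN : ((Fintype.card α).factorial : ℝ) ≠ 0 := by positivity
  have hcast : (((Fintype.card α - 1 : ℕ) : ℝ)) = Fintype.card α - 1 := by
    rw [Nat.cast_sub (by lia), Nat.cast_one]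
  rw [← Nat.cast_inj (R := ℝ), ← htr, Nat.cast_pow, hcast, smul_eq_mul]
  field_simp

theorem card_ne_eq_sub_fixChar (g h : Perm α) :
    ((#{i | g i ≠ h i} : ℕ) : ℝ) = Fintype.card α - fixChar (g⁻¹ * h) := by
  have hfix : fixChar (g⁻¹ * h) = (#{i | g i = h i} : ℕ) := by
    simp [fixChar_inv_mul]
  rw [hfix, eq_sub_iff_add_eq', ← Nat.cast_add, Finset.card_filter_add_card_filter_not,
    Finset.card_univ]

end HammingMDS


/-- For `n ≥ 4`, the centered MDS matrix
`M = −(1/2) H (D ∘ D) H` of `S_n` with the Hamming distance has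
`(2n−3)·n!/(2n−2)` as an eigenvalue, with eigenspace of dimension exactly
`(n−1)²`. -/
theorem mds_top_eigenvalue_hamming_symmetric_group (n : ℕ) (hn : 4 ≤ n)
    (D : Matrix (Equiv.Perm (Fin n)) (Equiv.Perm (Fin n)) ℝ)
    (hD : ∀ g h : Equiv.Perm (Fin n),
      D g h = ((Finset.univ.filter fun i => g i ≠ h i).card : ℝ))
    (H : Matrix (Equiv.Perm (Fin n)) (Equiv.Perm (Fin n)) ℝ)
    (hH : H = 1 - (Fintype.card (Equiv.Perm (Fin n)) : ℝ)⁻¹ • Matrix.of fun _ _ => (1 : ℝ))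
    (M : Matrix (Equiv.Perm (Fin n)) (Equiv.Perm (Fin n)) ℝ)
    (hM : M = (-(1/2 : ℝ)) • (H * (Matrix.hadamard D D) * H)) :
    Module.End.HasEigenvalue M.mulVecLin
        ((2 * (n : ℝ) - 3) * (Nat.factorial n : ℝ) / (2 * (n : ℝ) - 2)) ∧
      Module.finrank ℝ
          (Module.End.eigenspace M.mulVecLin
            ((2 * (n : ℝ) - 3) * (Nat.factorial n : ℝ) / (2 * (n : ℝ) - 2))) =
        (n - 1) ^ 2 := by
  have hcard : Fintype.card (Fin n) = n := Fintype.card_fin n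
  have hM' : M = (Fintype.card (Fin n) : ℝ) • HammingMDS.stdMatrix -
      (1 / 2 : ℝ) • (HammingMDS.convMatrix fun s => HammingMDS.fixChar s ^ 2) +
        HammingMDS.onesMatrix := by
    rw [← HammingMDS.centered_sq_hamming_eq (by lia), hM, hH, Fintype.card_perm]
    congr 3
    ext g h
    simp only [Matrix.hadamard_apply, hD, HammingMDS.card_ne_eq_sub_fixChar, Matrix.add_apply,
      Matrix.sub_apply, Matrix.smul_apply, HammingMDS.onesMatrix, HammingMDS.convMatrix,
      Matrix.of_apply, smul_eq_mul]
    ring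
  have hrank := HammingMDS.finrank_eigenspace (by lia) M hM'
  rw [hcard] at hrank
  refine ⟨fun hbot => ?_, hrank⟩
  rw [Module.End.eigenspace, hbot, finrank_bot] at hrank
  exact absurd hrank.symm (pow_ne_zero 2 (by lia))
end
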